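/- arXiv:2101.03488 — 2 statements merged into one kernel-verified Lean document; each statement's English description precedes it below -/
import Mathlib

section
/- The element R satisfies: Q(R) = 0, K(R) = −c_G (a constant in A ⊆ 𝒜), and for every λ ∈ ℤ and every f ∈ 𝒜_λ one has ℓ₂ᴷ(R, f) = λ·f. -/
open MvPolynomial

namespace PeriodCI

/-- The coordinate ring `A = ℂ[q_1,…,q_N]`, `N = n+k+1`, with `q_1,…,q_k` the `y`-variables
and `q_{k+1},…,q_N` the `x`-variables. -/
abbrev CoordRing (n k : ℕ) := MvPolynomial (Fin (n + k + 1)) ℂ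

/-- The super-algebra `𝒜 = A[η_1,…,η_N]`, modelled as functions from subsets
`T ⊆ {1,…,N}` (the monomial `η_T`) to `A`. -/
abbrev SuperAlg (n k : ℕ) := Finset (Fin (n + k + 1)) → CoordRing n k

/-- the variable `y_i` among the `q`'s. -/
def yVar (n k : ℕ) (i : Fin k) : Fin (n + k + 1) := ⟨i.1, by have := i.isLt; omega⟩

/-- the variable `x_j` among the `q`'s. -/
def xVar (n k : ℕ) (j : Fin (n + 1)) : Fin (n + k + 1) := ⟨k + j.1, by have := j.isLt; omega⟩

/-- The Dwork potential `S = Σ_{i=1}^k y_i · G_i(x)`. -/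
noncomputable def dwork (n k : ℕ) (G : Fin k → MvPolynomial (Fin (n + 1)) ℂ) : CoordRing n k :=
  ∑ i : Fin k, X (yVar n k i) * rename (xVar n k) (G i)

/-- The odd derivation `∂/∂η_i` of `𝒜` (A-linear, with `∂η_j/∂η_i = δ_{ij}`). -/
noncomputable def etaDeriv (n k : ℕ) (i : Fin (n + k + 1)) (f : SuperAlg n k) : SuperAlg n k :=
  fun s =>
    if i ∈ s then 0
    else (-1 : CoordRing n k) ^ (s.filter fun j => j < i).card * f (insert i s)

/-- `Q = Σ_i (∂P/∂q_i)·(∂/∂η_i)` for a potential `P`. -/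
noncomputable def Qop (n k : ℕ) (P : CoordRing n k) (f : SuperAlg n k) : SuperAlg n k :=
  fun s => ∑ i : Fin (n + k + 1), pderiv i P * etaDeriv n k i f s

/-- `Δ = Σ_i (∂/∂q_i)(∂/∂η_i)`. -/
noncomputable def Dop (n k : ℕ) (f : SuperAlg n k) : SuperAlg n k :=
  fun s => ∑ i : Fin (n + k + 1), pderiv i (etaDeriv n k i f s)

/-- `K = Q + Δ`. -/
noncomputable def Kop (n k : ℕ) (P : CoordRing n k) (f : SuperAlg n k) : SuperAlg n k :=
  fun s => Qop n k P f s + Dop n k f s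

/-- The Koszul sign `(−1)^{#{(i,j) ∈ t×u : i > j}}`. -/
def ksign (n k : ℕ) (t u : Finset (Fin (n + k + 1))) : ℤ :=
  (-1) ^ ((t ×ˢ u).filter fun p => p.2 < p.1).card

/-- The super-commutative product of `𝒜` (Koszul signs from `η_iη_j = −η_jη_i`). -/
noncomputable def gmul (n k : ℕ) (f g : SuperAlg n k) : SuperAlg n k :=
  fun s => ∑ t ∈ s.powerset, ksign n k t (s \ t) • (f t * g (s \ t))

/-- `f` is homogeneous of `η`-degree `d` (i.e. of cohomological degree `−d`):
it is supported on subsets of cardinality `d`. -/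
def IsEDeg (n k : ℕ) (d : ℕ) (f : SuperAlg n k) : Prop :=
  ∀ s : Finset (Fin (n + k + 1)), s.card ≠ d → f s = 0

/-- The descendant bracket `ℓ₂ᴷ(a,b) = K(a·b) − K(a)·b − (−1)^{|a|}·a·K(b)` for `a`
homogeneous of `η`-degree `da` (so of cohomological degree `|a| = −da`;
only the parity of `da` enters the sign). -/
noncomputable def ell2 (n k : ℕ) (P : CoordRing n k) (da : ℕ) (a b : SuperAlg n k) :
    SuperAlg n k :=
  Kop n k P (gmul n k a b) - gmul n k (Kop n k P a) b
    - ((-1 : ℤ) ^ da) • gmul n k a (Kop n k P b)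

/-- The embedding `A ⊆ 𝒜` in degree 0. -/
noncomputable def embA (n k : ℕ) (p : CoordRing n k) : SuperAlg n k := fun s => if s = ∅ then p else 0

/-- The charge of the variable `q_μ`: `ch(y_i) = −d_i`, `ch(x_j) = 1`. -/
def chq (n k : ℕ) (d : Fin k → ℕ) (μ : Fin (n + k + 1)) : ℤ :=
  if h : (μ : ℕ) < k then -(d ⟨μ, h⟩ : ℤ) else 1

/-- The charge of the monomial `q^m · η_s` (with `ch(η_μ) = −ch(q_μ)`). -/
def chOf (n k : ℕ) (d : Fin k → ℕ) (m : Fin (n + k + 1) →₀ ℕ)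
    (s : Finset (Fin (n + k + 1))) : ℤ :=
  (∑ μ : Fin (n + k + 1), (m μ : ℤ) * chq n k d μ) - ∑ μ ∈ s, chq n k d μ

/-- `f ∈ 𝒜_λ`: every monomial of `f` has charge `λ`. -/
def HasCharge (n k : ℕ) (d : Fin k → ℕ) (lam : ℤ) (f : SuperAlg n k) : Prop :=
  ∀ s : Finset (Fin (n + k + 1)), ∀ m ∈ (f s).support, chOf n k d m s = lam

/-- The weight of the variable `q_μ`: `wt(y_i) = 1`, `wt(x_j) = 0`. -/
def wtq (n k : ℕ) (μ : Fin (n + k + 1)) : ℕ := if (μ : ℕ) < k then 1 else 0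

/-- The weight of the monomial `q^m · η_s` (with `wt(η_μ) = 1 − wt(q_μ)`). -/
def wtOf (n k : ℕ) (m : Fin (n + k + 1) →₀ ℕ) (s : Finset (Fin (n + k + 1))) : ℕ :=
  (∑ μ : Fin (n + k + 1), m μ * wtq n k μ) + (s.filter fun μ : Fin (n + k + 1) => ¬ ((μ : ℕ) < k)).card

/-- `f ∈ 𝒜_{(w)}`: every monomial of `f` has weight `w` (stated with `w : ℤ` so that
`𝒜_{(−1)} = 0` is automatic). -/
def HasWeight (n k : ℕ) (w : ℤ) (f : SuperAlg n k) : Prop :=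
  ∀ s : Finset (Fin (n + k + 1)), ∀ m ∈ (f s).support, (wtOf n k m s : ℤ) = w

/-- `f ∈ F^j_wt 𝒜 = ⊕_{0 ≤ w ≤ j} 𝒜_{(w)}`. -/
def InWtFilt (n k : ℕ) (j : ℕ) (f : SuperAlg n k) : Prop :=
  ∀ s : Finset (Fin (n + k + 1)), ∀ m ∈ (f s).support, wtOf n k m s ≤ j

/-- `R = Σ_μ ch(q_μ)·q_μ·η_μ`. -/
noncomputable def Rel (n k : ℕ) (d : Fin k → ℕ) : SuperAlg n k :=
  fun s => ∑ μ : Fin (n + k + 1), if s = {μ} then chq n k d μ • X μ else 0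

/-- The background charge `c_G = Σ_i d_i − (n+1)`. -/
def cG (n k : ℕ) (d : Fin k → ℕ) : ℤ := (∑ i : Fin k, (d i : ℤ)) - (n + 1)


section WeightedHomogeneous

variable {σ τ R : Type*}

theorem isWeightedHomogeneous_rename [CommSemiring R] {M : Type*} [AddCommMonoid M]
    {w : τ → M} {g : σ → τ} {p : MvPolynomial σ R} {m : M}
    (hp : p.IsWeightedHomogeneous (w ∘ g) m) : (rename g p).IsWeightedHomogeneous w m := by
  intro e he
  obtain ⟨u, rfl, hu⟩ := coeff_rename_ne_zero g p e he
  rw [← hp hu]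
  exact Finsupp.linearCombination_mapDomain ℕ g u

theorem isWeightedHomogeneous_intCast_of_isHomogeneous [CommSemiring R]
    {p : MvPolynomial σ R} {m : ℕ} (hp : p.IsHomogeneous m) :
    p.IsWeightedHomogeneous (fun _ => (1 : ℤ)) m := by
  intro e he
  rw [← hp he]
  simp [Finsupp.weight_apply, Finsupp.sum]

/-- Euler's identity for integer weights. -/
theorem sum_zsmul_X_mul_pderiv [CommRing R] [Fintype σ] {w : σ → ℤ} {p : MvPolynomial σ R}
    {m : ℤ} (hp : p.IsWeightedHomogeneous w m) :
    ∑ i, w i • (X i * pderiv i p) = m • p := by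
  have key : ∀ e ∈ p.support,
      ∑ i, w i • (X i * pderiv i (monomial e (coeff e p))) = m • monomial e (coeff e p) := by
    intro e he
    rw [← hp (mem_support_iff.1 he), Finsupp.weight_apply, Finsupp.sum_fintype _ _ (by simp),
      Finset.sum_smul]
    refine Finset.sum_congr rfl fun i _ => ?_
    rw [X_mul_pderiv_monomial, ← natCast_zsmul, smul_smul]
    simp [mul_comm]
  conv_lhs => rw [p.as_sum]
  conv_rhs => rw [p.as_sum]
  simp only [map_sum, Finset.mul_sum, Finset.smul_sum]
  rw [Finset.sum_comm]
  refine Finset.sum_congr rfl fun e he => ?_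
  rw [key e he]

end WeightedHomogeneous

theorem chq_yVar (n k : ℕ) (d : Fin k → ℕ) (i : Fin k) : chq n k d (yVar n k i) = -(d i : ℤ) := by
  simp [chq, yVar]

theorem chq_xVar (n k : ℕ) (d : Fin k → ℕ) (j : Fin (n + 1)) : chq n k d (xVar n k j) = 1 := by
  simp [chq, xVar]

theorem sum_chq (n k : ℕ) (d : Fin k → ℕ) : ∑ i, chq n k d i = -cG n k d := by
  have h : k + (n + 1) = n + k + 1 := by omega
  rw [← Equiv.sum_comp (finCongr h), Fin.sum_univ_add]
  have hy : ∀ i : Fin k, chq n k d (finCongr h (Fin.castAdd (n + 1) i)) = -(d i : ℤ) :=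
    fun i => chq_yVar n k d i
  have hx : ∀ j : Fin (n + 1), chq n k d (finCongr h (Fin.natAdd k j)) = 1 :=
    fun j => chq_xVar n k d j
  simp only [hy, hx, cG, Finset.sum_neg_distrib, Finset.sum_const, Finset.card_univ,
    Fintype.card_fin, nsmul_eq_mul]
  push_cast
  ring

theorem isWeightedHomogeneous_dwork (n k : ℕ) (d : Fin k → ℕ)
    (G : Fin k → MvPolynomial (Fin (n + 1)) ℂ) (hG : ∀ i, (G i).IsHomogeneous (d i)) :
    (dwork n k G).IsWeightedHomogeneous (chq n k d) 0 := by
  refine IsWeightedHomogeneous.sum _ _ _ fun i _ => ?_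
  have hx : chq n k d ∘ xVar n k = fun _ => 1 := funext (chq_xVar n k d)
  have h := (isWeightedHomogeneous_X ℂ (chq n k d) (yVar n k i)).mul
    (isWeightedHomogeneous_rename (w := chq n k d) (g := xVar n k)
      (hx ▸ isWeightedHomogeneous_intCast_of_isHomogeneous (hG i)))
  rwa [chq_yVar, neg_add_cancel] at h

/-- The sign picked up when `η_j` moves past the factors of `η_s` with smaller index. -/
noncomputable def etaSign (n k : ℕ) (j : Fin (n + k + 1)) (s : Finset (Fin (n + k + 1))) :
    CoordRing n k :=
  (-1) ^ (s.filter fun u => u < j).card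

/-- Left multiplication by `η_j`. -/
noncomputable def etaMul (n k : ℕ) (j : Fin (n + k + 1)) (f : SuperAlg n k) : SuperAlg n k :=
  fun s => if j ∈ s then etaSign n k j s * f (s.erase j) else 0

section

variable {n k : ℕ}

theorem etaDeriv_apply (i : Fin (n + k + 1)) (f : SuperAlg n k) (s : Finset (Fin (n + k + 1))) :
    etaDeriv n k i f s = if i ∈ s then 0 else etaSign n k i s * f (insert i s) := rfl

theorem etaSign_mul_self (j : Fin (n + k + 1)) (s : Finset (Fin (n + k + 1))) :
    etaSign n k j s * etaSign n k j s = 1 := by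
  rw [etaSign, ← mul_pow]
  simp

theorem etaSign_insert {i j : Fin (n + k + 1)} {s : Finset (Fin (n + k + 1))} (hi : i ∉ s) :
    etaSign n k j (insert i s) = if i < j then -etaSign n k j s else etaSign n k j s := by
  rw [etaSign, etaSign, Finset.filter_insert]
  split_ifs with h
  · rw [Finset.card_insert_of_notMem (by simp [hi]), pow_succ]
    ring
  · rfl

theorem pderiv_etaSign_mul (i j : Fin (n + k + 1)) (s : Finset (Fin (n + k + 1)))
    (p : CoordRing n k) : pderiv i (etaSign n k j s * p) = etaSign n k j s * pderiv i p := by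
  rcases neg_one_pow_eq_or (CoordRing n k) (s.filter fun u => u < j).card with h | h <;>
    simp [etaSign, h]

/-- The Clifford relation between `∂/∂η_i` and multiplication by `η_j`. -/
theorem etaDeriv_etaMul_add (i j : Fin (n + k + 1)) (f : SuperAlg n k)
    (s : Finset (Fin (n + k + 1))) :
    etaDeriv n k i (etaMul n k j f) s + etaMul n k j (etaDeriv n k i f) s =
      if i = j then f s else 0 := by
  rcases eq_or_ne i j with rfl | hij
  · by_cases hi : i ∈ s
    · have h : etaSign n k i s = etaSign n k i (s.erase i) := by
        conv_lhs => rw [← Finset.insert_erase hi, etaSign_insert (Finset.notMem_erase i s)]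
        simp
      simp [etaDeriv_apply, etaMul, hi, h, ← mul_assoc, etaSign_mul_self]
    · simp [etaDeriv_apply, etaMul, hi, etaSign_insert hi, ← mul_assoc, etaSign_mul_self]
  · by_cases hi : i ∈ s
    · simp [etaDeriv_apply, etaMul, hi, hij]
    by_cases hj : j ∈ s
    · have hjs : etaSign n k i s =
          if j < i then -etaSign n k i (s.erase j) else etaSign n k i (s.erase j) := by
        conv_lhs => rw [← Finset.insert_erase hj, etaSign_insert (Finset.notMem_erase j s)]
      have hins : (insert i s).erase j = insert i (s.erase j) :=
        Finset.erase_insert_of_ne hij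
      simp only [etaDeriv_apply, etaMul, hi, hj, hij, hins, if_false, if_true,
        Finset.mem_insert, Finset.mem_erase, or_true, and_false, etaSign_insert hi, hjs]
      rcases lt_or_gt_of_ne hij with h | h
      · simp only [h, not_lt_of_gt h, if_true, if_false]
        ring
      · simp only [h, not_lt_of_gt h, if_true, if_false]
        ring
    · simp [etaDeriv_apply, etaMul, hi, hj, hij, hij.symm]

theorem etaDeriv_etaMul_self (i : Fin (n + k + 1)) (f : SuperAlg n k)
    (s : Finset (Fin (n + k + 1))) :
    etaDeriv n k i (etaMul n k i f) s = if i ∈ s then 0 else f s := by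
  by_cases hi : i ∈ s
  · simp [etaDeriv_apply, hi]
  · have h := etaDeriv_etaMul_add i i f s
    simpa [hi, etaMul] using h

theorem ksign_singleton (j : Fin (n + k + 1)) (s : Finset (Fin (n + k + 1))) :
    ((ksign n k {j} (s \ {j}) : ℤ) : CoordRing n k) = etaSign n k j s := by
  have h : ((({j} : Finset (Fin (n + k + 1))) ×ˢ (s \ {j})).filter fun p => p.2 < p.1).card =
      (s.filter fun u => u < j).card := by
    refine Finset.card_bij (fun p _ => p.2) ?_ ?_ ?_
    · rintro ⟨a, b⟩ h
      simp at h ⊢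
      grind
    · rintro ⟨a, b⟩ h ⟨a', b'⟩ h' he
      simp at h h' he ⊢
      grind
    · intro b hb
      refine ⟨(j, b), ?_, rfl⟩
      simp at hb ⊢
      grind
  rw [ksign, h, etaSign]
  push_cast
  rfl

theorem gmul_Rel (d : Fin k → ℕ) (f : SuperAlg n k) (s : Finset (Fin (n + k + 1))) :
    gmul n k (Rel n k d) f s = ∑ j, (chq n k d j : CoordRing n k) * X j * etaMul n k j f s := by
  simp only [gmul, Rel, Finset.sum_mul, Finset.smul_sum, ite_mul, zero_mul, smul_ite, smul_zero]
  rw [Finset.sum_comm]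
  refine Finset.sum_congr rfl fun j _ => ?_
  rw [Finset.sum_ite_eq' s.powerset {j}]
  simp only [Finset.mem_powerset, Finset.singleton_subset_iff, etaMul]
  split_ifs
  · rw [zsmul_eq_mul, zsmul_eq_mul, ksign_singleton, Finset.sdiff_singleton_eq_erase]
    ring
  · simp

theorem gmul_embA (p : CoordRing n k) (f : SuperAlg n k) (s : Finset (Fin (n + k + 1))) :
    gmul n k (embA n k p) f s = p * f s := by
  simp only [gmul, embA, ite_mul, zero_mul, smul_ite, smul_zero]
  rw [Finset.sum_ite_eq' s.powerset ∅]
  simp [ksign]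

theorem etaDeriv_gmul_Rel (d : Fin k → ℕ) (i : Fin (n + k + 1)) (f : SuperAlg n k)
    (s : Finset (Fin (n + k + 1))) :
    etaDeriv n k i (gmul n k (Rel n k d) f) s =
      ∑ j, (chq n k d j : CoordRing n k) * X j * etaDeriv n k i (etaMul n k j f) s := by
  simp only [etaDeriv_apply, gmul_Rel]
  split_ifs
  · simp
  · rw [Finset.mul_sum]
    exact Finset.sum_congr rfl fun j _ => by ring

theorem Kop_apply (P : CoordRing n k) (f : SuperAlg n k) (s : Finset (Fin (n + k + 1))) :
    Kop n k P f s =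
      ∑ i, (pderiv i P * etaDeriv n k i f s + pderiv i (etaDeriv n k i f s)) := by
  simp only [Kop, Qop, Dop, Finset.sum_add_distrib]

theorem etaMul_Kop (P : CoordRing n k) (j : Fin (n + k + 1)) (f : SuperAlg n k)
    (s : Finset (Fin (n + k + 1))) :
    etaMul n k j (Kop n k P f) s =
      ∑ i, (pderiv i P * etaMul n k j (etaDeriv n k i f) s +
        pderiv i (etaMul n k j (etaDeriv n k i f) s)) := by
  simp only [etaMul, Kop_apply]
  split_ifs
  · rw [Finset.mul_sum]
    exact Finset.sum_congr rfl fun i _ => by rw [pderiv_etaSign_mul]; ring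
  · simp

theorem pderiv_intCast_mul_X_mul (c : ℤ) (i j : Fin (n + k + 1)) (p : CoordRing n k) :
    pderiv i ((c : CoordRing n k) * X j * p) =
      (if i = j then (c : CoordRing n k) * p else 0) + (c : CoordRing n k) * X j * pderiv i p := by
  rw [Derivation.leibniz, Derivation.leibniz, pderiv_X, Derivation.map_intCast]
  rcases eq_or_ne i j with rfl | h
  · simp
    ring
  · simp [h, h.symm]

/-- The anticommutator of `K` with left multiplication by `R`. -/
theorem Kop_gmul_Rel_add (P : CoordRing n k) (d : Fin k → ℕ) (f : SuperAlg n k)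
    (s : Finset (Fin (n + k + 1))) :
    Kop n k P (gmul n k (Rel n k d) f) s + gmul n k (Rel n k d) (Kop n k P f) s =
      (∑ i, chq n k d i • (X i * pderiv i P)) * f s +
        (∑ i, chq n k d i • (X i * pderiv i (f s)) +
          ∑ i, if i ∈ s then 0 else (chq n k d i : CoordRing n k) * f s) := by
  have hterm : ∀ i j : Fin (n + k + 1),
      pderiv i P * ((chq n k d j : CoordRing n k) * X j * etaDeriv n k i (etaMul n k j f) s) +
        pderiv i ((chq n k d j : CoordRing n k) * X j * etaDeriv n k i (etaMul n k j f) s) +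
        (chq n k d j : CoordRing n k) * X j *
          (pderiv i P * etaMul n k j (etaDeriv n k i f) s +
            pderiv i (etaMul n k j (etaDeriv n k i f) s)) =
      if i = j then chq n k d i • (X i * pderiv i P) * f s +
        (chq n k d i • (X i * pderiv i (f s)) +
          if i ∈ s then 0 else (chq n k d i : CoordRing n k) * f s) else 0 := by
    intro i j
    have h := etaDeriv_etaMul_add i j f s
    have hd := congrArg (pderiv i) h
    rw [map_add] at hd
    rw [pderiv_intCast_mul_X_mul]
    rcases eq_or_ne i j with rfl | hij
    · have hself := etaDeriv_etaMul_self i f s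
      simp only [if_true, zsmul_eq_mul] at h hd ⊢
      have hs : (if i ∈ s then 0 else (chq n k d i : CoordRing n k) * f s) =
          (chq n k d i : CoordRing n k) * etaDeriv n k i (etaMul n k i f) s := by
        rw [hself]
        split_ifs <;> simp
      rw [hs]
      linear_combination (chq n k d i : CoordRing n k) * X i * pderiv i P * h +
        (chq n k d i : CoordRing n k) * X i * hd
    · simp only [hij, if_false, map_zero] at h hd ⊢
      linear_combination (chq n k d j : CoordRing n k) * X j * pderiv i P * h +
        (chq n k d j : CoordRing n k) * X j * hd
  rw [Kop_apply, gmul_Rel]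
  simp only [etaDeriv_gmul_Rel, etaMul_Kop, map_sum, Finset.mul_sum]
  rw [Finset.sum_comm (f := fun j i => (chq n k d j : CoordRing n k) * X j *
    (pderiv i P * etaMul n k j (etaDeriv n k i f) s +
      pderiv i (etaMul n k j (etaDeriv n k i f) s)))]
  simp only [← Finset.sum_add_distrib, hterm, Finset.sum_ite_eq, Finset.mem_univ, if_true,
    Finset.sum_mul]

theorem etaDeriv_Rel (d : Fin k → ℕ) (i : Fin (n + k + 1)) (s : Finset (Fin (n + k + 1))) :
    etaDeriv n k i (Rel n k d) s = if s = ∅ then chq n k d i • X i else 0 := by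
  rw [etaDeriv_apply]
  split_ifs with hi hs hs
  · simp [hs] at hi
  · rfl
  · subst hs
    simp [etaSign, Rel, Finset.singleton_inj]
  · have h : ∀ μ, insert i s ≠ {μ} := by
      intro μ hμ
      obtain ⟨a, ha⟩ := Finset.nonempty_iff_ne_empty.2 hs
      have h1 : i = μ := Finset.mem_singleton.1 (hμ ▸ Finset.mem_insert_self i s)
      have h2 : a = μ := Finset.mem_singleton.1 (hμ ▸ Finset.mem_insert_of_mem ha)
      exact hi (h1.trans h2.symm ▸ ha)
    simp [Rel, h]

theorem Qop_Rel (P : CoordRing n k) (d : Fin k → ℕ) :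
    Qop n k P (Rel n k d) = embA n k (∑ i, chq n k d i • (X i * pderiv i P)) := by
  funext s
  simp only [Qop, etaDeriv_Rel, embA]
  split_ifs
  · exact Finset.sum_congr rfl fun i _ => by rw [mul_smul_comm, mul_comm]
  · simp

theorem Dop_Rel (d : Fin k → ℕ) :
    Dop n k (Rel n k d) = embA n k ((-(cG n k d) : ℤ) : CoordRing n k) := by
  funext s
  simp only [Dop, etaDeriv_Rel, embA]
  split_ifs
  · rw [← sum_chq]
    simp
  · simp

theorem isWeightedHomogeneous_of_hasCharge {d : Fin k → ℕ} {lam : ℤ} {f : SuperAlg n k}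
    (hf : HasCharge n k d lam f) (s : Finset (Fin (n + k + 1))) :
    (f s).IsWeightedHomogeneous (chq n k d) (lam + ∑ μ ∈ s, chq n k d μ) := by
  intro m hm
  rw [← hf s m (mem_support_iff.2 hm), chOf, Finsupp.weight_apply,
    Finsupp.sum_fintype _ _ (by simp)]
  simp

end

/-- the element `R = Σ_μ ch(q_μ)·q_μ·η_μ` satisfies `Q(R) = 0`,
`K(R) = −c_G` (a constant in `A ⊆ 𝒜`), and `ℓ₂ᴷ(R, f) = λ·f` for every `f ∈ 𝒜_λ`
(`R` has `η`-degree 1, i.e. cohomological degree `−1`). -/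
theorem stmt8 (n k : ℕ) (hk : 1 ≤ k) (hkn : k ≤ n)
    (d : Fin k → ℕ) (hd : ∀ i, 1 ≤ d i)
    (G : Fin k → MvPolynomial (Fin (n + 1)) ℂ)
    (hG : ∀ i, (G i).IsHomogeneous (d i)) :
    Qop n k (dwork n k G) (Rel n k d) = 0 ∧
    Kop n k (dwork n k G) (Rel n k d) = embA n k ((-(cG n k d) : ℤ) : CoordRing n k) ∧
    (∀ (lam : ℤ) (f : SuperAlg n k), HasCharge n k d lam f →
      ell2 n k (dwork n k G) 1 (Rel n k d) f = lam • f) := by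
  have hS : ∑ i, chq n k d i • (X i * pderiv i (dwork n k G)) = 0 := by
    rw [sum_zsmul_X_mul_pderiv (isWeightedHomogeneous_dwork n k d G hG), zero_smul]
  have hQ : Qop n k (dwork n k G) (Rel n k d) = 0 := by
    rw [Qop_Rel, hS]
    funext s
    simp [embA]
  have hK : Kop n k (dwork n k G) (Rel n k d) =
      embA n k ((-(cG n k d) : ℤ) : CoordRing n k) := by
    funext s
    simp [Kop, hQ, Dop_Rel]
  refine ⟨hQ, hK, fun lam f hf => ?_⟩
  funext s
  have h := Kop_gmul_Rel_add (dwork n k G) d f s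
  rw [hS, sum_zsmul_X_mul_pderiv (isWeightedHomogeneous_of_hasCharge hf s)] at h
  have hc : (∑ i, if i ∈ s then 0 else (chq n k d i : CoordRing n k) * f s) =
      (-(cG n k d) - ∑ i ∈ s, chq n k d i : ℤ) • f s := by
    rw [← sum_chq, ← Finset.sum_add_sum_compl s (chq n k d), add_sub_cancel_left,
      Finset.sum_smul, ← Finset.sum_add_sum_compl s, Finset.sum_eq_zero (s := s) fun i hi => if_pos hi, zero_add]
    refine Finset.sum_congr rfl fun i hi => ?_
    rw [if_neg (Finset.mem_compl.1 hi), zsmul_eq_mul]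
  rw [hc] at h
  rw [ell2, pow_one, neg_smul, one_smul, hK]
  simp only [Pi.sub_apply, Pi.neg_apply, Pi.smul_apply, gmul_embA, zsmul_eq_mul] at h ⊢
  push_cast at h ⊢
  linear_combination h

end PeriodCI
end

section
/- Let X_G and X_U be smooth complete intersections in ℙⁿ(ℂ) of the same multidegree (d_1, …, d_k), defined by homogeneous tuples (G_1,…,G_k) and (U_1,…,U_k) respectively. Then there exists a continuous map F : [0,1] × ℙⁿ(ℂ) → ℙⁿ(ℂ) such that F(0,·) is the identity of ℙⁿ(ℂ), F(t,·) is a homeomorphism of ℙⁿ(ℂ) for every t ∈ [0,1], and F(1,·) maps X_G onto X_U; in particular X_G and X_U are homeomorphic. (This is the topological content of Proposition A.1 of the paper, whose proof produces an ambient isotopy via the integral flow of a vector field obtained from Ehresmann's theorem applied to the family t_0·G + t_1·U over an arc in ℙ¹(ℂ) avoiding the singular parameters.) -/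
open MvPolynomial

namespace AmbientIsotopy

/-- Nonzero vectors in `ℂ^{n+1}`, with the subspace topology. -/
abbrev NZ (n : ℕ) := {v : Fin (n + 1) → ℂ // v ≠ 0}

/-- The scaling equivalence relation on nonzero vectors. -/
def projSetoid (n : ℕ) : Setoid (NZ n) where
  r v w := ∃ c : ℂ, c ≠ 0 ∧ c • v.1 = w.1
  iseqv := by
    refine ⟨fun v => ⟨1, one_ne_zero, one_smul _ _⟩, ?_, ?_⟩
    · rintro v w ⟨c, hc, h⟩
      exact ⟨c⁻¹, inv_ne_zero hc, by rw [← h, smul_smul, inv_mul_cancel₀ hc, one_smul]⟩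
    · rintro u v w ⟨c, hc, h⟩ ⟨c', hc', h'⟩
      exact ⟨c' * c, mul_ne_zero hc' hc, by rw [← h', ← h, smul_smul]⟩

/-- Complex projective `n`-space `ℙⁿ(ℂ) = (ℂ^{n+1}∖{0})/ℂ*`, with the quotient topology. -/
abbrev ProjSp (n : ℕ) := Quotient (projSetoid n)

/-- The common zero locus `X_P ⊆ ℙⁿ(ℂ)` of a tuple of homogeneous polynomials. -/
def zeroLocus (n k : ℕ) (P : Fin k → MvPolynomial (Fin (n + 1)) ℂ) : Set (ProjSp n) :=
  {x | ∃ v : NZ n, Quotient.mk (projSetoid n) v = x ∧ ∀ i, eval v.1 (P i) = 0}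

/-- `(P_1,…,P_k)` cuts out a smooth complete intersection of multidegree `(d_1,…,d_k)`:
each `P_i` is homogeneous of degree `d_i`, and at every point `a ≠ 0` of the affine cone
the Jacobian matrix `(∂P_i/∂x_j(a))` has rank `k`. -/
def IsSmoothCI (n k : ℕ) (P : Fin k → MvPolynomial (Fin (n + 1)) ℂ) (d : Fin k → ℕ) : Prop :=
  (∀ i, (P i).IsHomogeneous (d i)) ∧
  ∀ a : Fin (n + 1) → ℂ, a ≠ 0 → (∀ i, eval a (P i) = 0) →
    (Matrix.of fun (i : Fin k) (j : Fin (n + 1)) => eval a (pderiv j (P i))).rank = k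

lemma eval_homogeneousComponent {σ R : Type*} [Fintype σ] [DecidableEq σ] [CommRing R]
    (D : ℕ) (p : MvPolynomial σ R) (a : σ → R) :
    eval a (homogeneousComponent D p) =
      ∑ m ∈ Finset.finsuppAntidiag (Finset.univ : Finset σ) D, coeff m p * ∏ i, a i ^ m i := by
  have hdeg : ∀ m : σ →₀ ℕ,
      m ∈ Finset.finsuppAntidiag (Finset.univ : Finset σ) D ↔ m.degree = D := by
    intro m
    simp [Finset.mem_finsuppAntidiag, Finsupp.degree_eq_sum]
  rw [eval_eq']
  rw [Finset.sum_subset (s₂ := Finset.finsuppAntidiag (Finset.univ : Finset σ) D)]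
  · refine Finset.sum_congr rfl fun m hm => ?_
    rw [coeff_homogeneousComponent, if_pos ((hdeg m).1 hm)]
  · intro m hm
    rw [support_homogeneousComponent] at hm
    exact (hdeg m).2 (Finset.mem_filter.1 hm).2
  · intro m _ hm
    rw [notMem_support_iff.1 hm, zero_mul]

lemma eval_homogeneousComponent_eq_zero {σ J : Type*}
    (f : J → MvPolynomial σ ℂ) (e : J → ℕ) (hf : ∀ j, (f j).IsHomogeneous (e j))
    {p : MvPolynomial σ ℂ} (hp : p ∈ Ideal.span (Set.range f)) (D : ℕ) (a : σ → ℂ)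
    (ha : ∀ j, eval a (f j) = 0) : eval a (homogeneousComponent D p) = 0 := by
  let _ : GradedAlgebra (homogeneousSubmodule σ ℂ) := gradedAlgebra
  have hI : (Ideal.span (Set.range f)).IsHomogeneous (homogeneousSubmodule σ ℂ) :=
    Ideal.homogeneous_span _ _ (by rintro _ ⟨j, rfl⟩; exact ⟨e j, hf j⟩)
  have hle : Ideal.span (Set.range f) ≤ RingHom.ker (eval a) :=
    Ideal.span_le.2 (by rintro _ ⟨j, rfl⟩; exact ha j)
  exact hle (homogeneousComponent_mem_of_mem hI hp D)

lemma exists_monomial_mem_span {σ J : Type*} [Fintype σ] [DecidableEq σ]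
    (f : J → MvPolynomial σ ℂ) (h0 : ∀ a, (∀ j, eval a (f j) = 0) → a = 0) :
    ∃ D : ℕ, 0 < D ∧ ∀ m ∈ Finset.finsuppAntidiag (Finset.univ : Finset σ) D,
      monomial m (1 : ℂ) ∈ Ideal.span (Set.range f) := by
  set I := Ideal.span (Set.range f) with hI
  have hX : ∀ i, (X i : MvPolynomial σ ℂ) ∈ I.radical := by
    intro i
    rw [← MvPolynomial.vanishingIdeal_zeroLocus_eq_radical (K := ℂ), mem_vanishingIdeal_iff]
    intro a ha
    have : a = 0 := h0 a fun j => by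
      simpa [coe_aeval_eq_eval] using ha (f j) (Ideal.subset_span ⟨j, rfl⟩)
    simp [this]
  choose N hN using hX
  let M := ∑ i, N i
  have hM : ∀ i, (X i : MvPolynomial σ ℂ) ^ M ∈ I := fun i =>
    I.pow_mem_of_pow_mem (hN i) (Finset.single_le_sum (fun _ _ => Nat.zero_le _)
      (Finset.mem_univ i))
  refine ⟨Fintype.card σ * M + 1, Nat.succ_pos _, fun m hm => ?_⟩
  have hsum : ∑ _i : σ, M < ∑ i, m i := by
    have : ∑ i, m i = Fintype.card σ * M + 1 := (Finset.mem_finsuppAntidiag.1 hm).1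
    simp only [Finset.sum_const, Finset.card_univ, smul_eq_mul]
    omega
  obtain ⟨i, -, hi⟩ := Finset.exists_lt_of_sum_lt hsum
  have : monomial m (1 : ℂ) = monomial (m - Finsupp.single i M) 1 * X i ^ M := by
    rw [X_pow_eq_monomial, monomial_mul, one_mul,
      tsub_add_cancel_of_le (Finsupp.single_le_iff.2 hi.le)]
  rw [this]
  exact Ideal.mul_mem_left _ _ (hM i)

/-- The parameters `s` at which a one-parameter family of homogeneous systems acquires a nonzero
solution are zeros of a polynomial that does not vanish at `s₀`, if there is none at `s₀`. -/
lemma exists_polynomial_elimination {σ J : Type*} [Finite σ] [Finite J]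
    (F : J → MvPolynomial σ (Polynomial ℂ)) (e : J → ℕ)
    (hF : ∀ s j, (map (Polynomial.evalRingHom s) (F j)).IsHomogeneous (e j)) (s₀ : ℂ)
    (h0 : ∀ a, (∀ j, eval a (map (Polynomial.evalRingHom s₀) (F j)) = 0) → a = 0) :
    ∃ q : Polynomial ℂ, q.eval s₀ ≠ 0 ∧ ∀ s a, a ≠ 0 →
      (∀ j, eval a (map (Polynomial.evalRingHom s) (F j)) = 0) → q.eval s = 0 := by
  classical
  have := Fintype.ofFinite σ
  have := Fintype.ofFinite J
  obtain ⟨D, hD, hmem⟩ := exists_monomial_mem_span _ h0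
  set T := Finset.finsuppAntidiag (Finset.univ : Finset σ) D with hT
  have hex : ∀ m : T, ∃ h : J → MvPolynomial σ ℂ,
      ∑ j, h j * map (Polynomial.evalRingHom s₀) (F j) = monomial m.1 1 := fun m =>
    Ideal.mem_span_range_iff_exists_fun.1 (hmem m.1 m.2)
  choose h hh using hex
  let R : T → MvPolynomial σ (Polynomial ℂ) := fun m => ∑ j, map Polynomial.C (h m j) * F j
  have hR : ∀ s m, map (Polynomial.evalRingHom s) (R m) =
      ∑ j, h m j * map (Polynomial.evalRingHom s) (F j) := by
    intro s m
    simp only [R, map_sum, map_mul, map_map]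
    refine Finset.sum_congr rfl fun j _ => ?_
    congr 1
    convert map_id (h m j)
    ext
    simp
  let A : Matrix T T (Polynomial ℂ) := Matrix.of fun m m' => coeff m'.1 (R m)
  have hA : ∀ s, A.det.eval s = Matrix.det (Matrix.of fun m m' : T =>
      coeff m'.1 (map (Polynomial.evalRingHom s) (R m))) := by
    intro s
    rw [← Polynomial.coe_evalRingHom, RingHom.map_det]
    congr 1
  refine ⟨A.det, ?_, fun s a ha hz => ?_⟩
  · rw [hA]
    have : (Matrix.of fun m m' : T => coeff m'.1 (map (Polynomial.evalRingHom s₀) (R m))) = 1 := by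
      ext m m'
      rw [Matrix.of_apply, hR, hh, coeff_monomial, Matrix.one_apply]
      simp only [Subtype.ext_iff]
    rw [this]
    simp
  · rw [hA, ← Matrix.exists_mulVec_eq_zero_iff]
    refine ⟨fun m => ∏ i, a i ^ m.1 i, ?_, ?_⟩
    · obtain ⟨i, hi⟩ := Function.ne_iff.1 ha
      intro h0
      have := congrFun h0 ⟨Finsupp.single i D, by simp [hT, Finset.mem_finsuppAntidiag]⟩
      simp only [Pi.zero_apply, Finset.prod_eq_zero_iff, Finset.mem_univ, true_and] at this
      obtain ⟨j, hj⟩ := this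
      by_cases hij : i = j
      · subst hij
        simp at hj
        exact hi hj.1
      · simp [hij] at hj
    · ext m
      have hmemR : map (Polynomial.evalRingHom s) (R m) ∈
          Ideal.span (Set.range fun j => map (Polynomial.evalRingHom s) (F j)) := by
        rw [hR]
        exact Ideal.mem_span_range_iff_exists_fun.2 ⟨_, rfl⟩
      have := eval_homogeneousComponent_eq_zero _ e (hF s) hmemR D a hz
      rw [eval_homogeneousComponent, ← Finset.sum_coe_sort] at this
      simpa [Matrix.mulVec, dotProduct] using this

lemma rank_eq_iff_exists_det_ne_zero {k m : ℕ} (A : Matrix (Fin k) (Fin m) ℂ) :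
    A.rank = k ↔ ∃ c : Fin k → Fin m, (A.submatrix id c).det ≠ 0 := by
  constructor
  · intro h
    have key : ∀ r : ℕ, A.rank = r → ∃ c : Fin r → Fin m,
        LinearIndependent ℂ fun l => A.col (c l) := by
      rintro r rfl
      rw [Matrix.rank_eq_finrank_span_cols]
      obtain ⟨f, hf, -, hli⟩ := Submodule.exists_fun_fin_finrank_span_eq ℂ (Set.range A.col)
      choose c hc using hf
      exact ⟨c, by simpa only [hc] using hli⟩
    obtain ⟨c, hc⟩ := key k h
    refine ⟨c, ?_⟩
    have : IsUnit (A.submatrix id c) := by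
      rw [← Matrix.linearIndependent_cols_iff_isUnit]
      exact hc
    exact ((Matrix.isUnit_iff_isUnit_det _).1 this).ne_zero
  · rintro ⟨c, hc⟩
    have h1 := Matrix.rank_of_det_ne_zero hc
    have h2 := Matrix.rank_submatrix_le A id c
    have h3 := Matrix.rank_le_height A
    simp only [Fintype.card_fin] at h1
    omega

/-- The linear pencil of tuples of polynomials through `G` and `U`. -/
noncomputable def pencil {n k : ℕ} (G U : Fin k → MvPolynomial (Fin (n + 1)) ℂ) (s : ℂ)
    (i : Fin k) : MvPolynomial (Fin (n + 1)) ℂ :=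
  C (1 - s) * G i + C s * U i

lemma isHomogeneous_det {σ R : Type*} [CommRing R] {k : ℕ} (e : Fin k → ℕ)
    (M : Matrix (Fin k) (Fin k) (MvPolynomial σ R)) (hM : ∀ i j, (M i j).IsHomogeneous (e i)) :
    M.det.IsHomogeneous (∑ i, e i) := by
  rw [Matrix.det_apply']
  refine IsHomogeneous.sum _ _ _ fun p _ => ?_
  have h1 : (∏ i, M (p i) i).IsHomogeneous (∑ i, e i) := by
    rw [← Equiv.sum_comp p]
    exact IsHomogeneous.prod _ _ _ fun i _ => hM _ _
  have h2 : ((p.sign : ℤ) : MvPolynomial σ R) = C ((p.sign : ℤ) : R) := by simp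
  rw [h2]
  exact h1.C_mul _

lemma finite_setOf_not_isSmoothCI {n k : ℕ} (d : Fin k → ℕ)
    (G U : Fin k → MvPolynomial (Fin (n + 1)) ℂ)
    (hG : IsSmoothCI n k G d) (hU : ∀ i, (U i).IsHomogeneous (d i)) :
    {s : ℂ | ¬ IsSmoothCI n k (pencil G U s) d}.Finite := by
  have hhom : ∀ s i, (pencil G U s i).IsHomogeneous (d i) := fun s i =>
    ((hG.1 i).C_mul _).add ((hU i).C_mul _)
  let P : Fin k → MvPolynomial (Fin (n + 1)) (Polynomial ℂ) := fun i =>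
    C (1 - Polynomial.X) * map Polynomial.C (G i) + C Polynomial.X * map Polynomial.C (U i)
  have hC : ∀ s, (Polynomial.evalRingHom s).comp Polynomial.C = RingHom.id ℂ := by
    intro s; ext; simp
  have hP : ∀ s i, map (Polynomial.evalRingHom s) (P i) = pencil G U s i := by
    intro s i
    simp [P, pencil, map_map, hC, MvPolynomial.map_id]
  let F : Fin k ⊕ (Fin k → Fin (n + 1)) → MvPolynomial (Fin (n + 1)) (Polynomial ℂ) :=
    Sum.elim P fun c => Matrix.det (Matrix.of fun i l => pderiv (c l) (P i))
  have hFl : ∀ s i, map (Polynomial.evalRingHom s) (F (Sum.inl i)) = pencil G U s i := hP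
  have hFr : ∀ s c, map (Polynomial.evalRingHom s) (F (Sum.inr c)) =
      Matrix.det (Matrix.of fun i l => pderiv (c l) (pencil G U s i)) := by
    intro s c
    simp only [F, Sum.elim_inr, RingHom.map_det]
    congr 1
    ext1 i l
    simp [← pderiv_map, hP]
  have hFe : ∀ s c a, eval a (map (Polynomial.evalRingHom s) (F (Sum.inr c))) =
      ((Matrix.of fun (i : Fin k) (j : Fin (n + 1)) =>
        eval a (pderiv j (pencil G U s i))).submatrix id c).det := by
    intro s c a
    rw [hFr, RingHom.map_det]
    rfl
  have h0 : pencil G U 0 = G := by ext1 i; simp [pencil]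
  obtain ⟨q, hq0, hq⟩ := exists_polynomial_elimination F
    (Sum.elim d fun _ => ∑ i, (d i - 1)) (by
      rintro s (i | c)
      · rw [hFl]; exact hhom s i
      · rw [hFr]
        exact isHomogeneous_det _ _ fun i l => (hhom s i).pderiv) 0 (by
      intro a ha
      by_contra hne
      have hz : ∀ i, eval a (G i) = 0 := fun i => by
        have := ha (Sum.inl i)
        rwa [hFl, h0] at this
      obtain ⟨c, hc⟩ := (rank_eq_iff_exists_det_ne_zero _).1 (hG.2 a hne hz)
      have := ha (Sum.inr c)
      rw [hFe, h0] at this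
      exact hc this)
  have hq' : q ≠ 0 := by rintro rfl; simp at hq0
  refine (Polynomial.finite_setOfPred_isRoot hq').subset fun s hs => ?_
  simp only [IsSmoothCI, Set.mem_ofPred_eq, not_and, not_forall] at hs
  obtain ⟨a, ha, hz, hr⟩ := hs (hhom s)
  refine hq s a ha ?_
  rintro (i | c)
  · rw [hFl]; exact hz i
  · rw [hFe]
    by_contra hc
    exact hr ((rank_eq_iff_exists_det_ne_zero _).2 ⟨c, hc⟩)

/-- A quadratic path in `ℂ` from `0` to `1`. -/
noncomputable def arc (c t : ℝ) : ℂ := t + Complex.I * (c * t * (1 - t))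

lemma exists_arc_notMem {B : Set ℂ} (hB : B.Finite) (h0 : 0 ∉ B) (h1 : 1 ∉ B) :
    ∃ c : ℝ, ∀ t : ℝ, arc c t ∉ B := by
  obtain ⟨c, hc⟩ := (hB.image fun b => b.im / (b.re * (1 - b.re))).exists_notMem
  refine ⟨c, fun t ht => hc ⟨_, ht, ?_⟩⟩
  have hre : (arc c t).re = t := by simp [arc]
  have him : (arc c t).im = c * t * (1 - t) := by simp [arc]
  have ht0 : t ≠ 0 := by rintro rfl; simp [arc] at ht; exact h0 ht
  have ht1 : 1 - t ≠ 0 := by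
    intro h
    obtain rfl : t = 1 := by linarith
    simp [arc] at ht; exact h1 ht
  simp only [hre, him]
  field_simp

section Lipschitz

open Set Metric
open scoped NNReal

variable {E : Type*} [NormedAddCommGroup E] [NormedSpace ℝ E]

/-- A time-dependent vector field that is positively homogeneous of degree one and locally
Lipschitz on the unit sphere is globally Lipschitz, uniformly over compact time intervals. -/
lemma exists_lipschitzWith_of_homogeneous [ProperSpace E] (v : ℝ → E → E) (I : Set ℝ)
    (hI : IsCompact I)
    (hv : ∀ t x (r : ℝ), 0 ≤ r → v t (r • x) = r • v t x)
    (hloc : LocallyLipschitzOn (I ×ˢ sphere (0 : E) 1) (Function.uncurry v)) :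
    ∃ K : ℝ≥0, ∀ t ∈ I, LipschitzWith K (v t) := by
  have hc : IsCompact (I ×ˢ sphere (0 : E) 1) := hI.prod (isCompact_sphere _ _)
  obtain ⟨K, hK⟩ := hloc.exists_lipschitzOnWith_of_compact hc
  obtain ⟨B, hB⟩ := hc.exists_bound_of_continuousOn hK.continuousOn
  have hv0 : ∀ t, v t 0 = 0 := fun t => by simpa using hv t 0 0 le_rfl
  have hscale : ∀ t x, v t x = ‖x‖ • v t (‖x‖⁻¹ • x) := by
    intro t x
    rcases eq_or_ne x 0 with rfl | hx
    · simp [hv0]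
    · rw [← hv t _ _ (norm_nonneg x), smul_smul, mul_inv_cancel₀ (norm_ne_zero_iff.2 hx), one_smul]
  have hmem : ∀ x : E, x ≠ 0 → ‖x‖⁻¹ • x ∈ sphere (0 : E) 1 := fun x hx => by
    rw [mem_sphere_zero_iff_norm, norm_smul, norm_inv, norm_norm,
      inv_mul_cancel₀ (norm_ne_zero_iff.2 hx)]
  have hbd : ∀ t ∈ I, ∀ x, ‖v t x‖ ≤ max B 0 * ‖x‖ := by
    intro t ht x
    rcases eq_or_ne x 0 with rfl | hx
    · simp [hv0]
    · rw [hscale, norm_smul, norm_norm, mul_comm]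
      gcongr
      exact (hB (t, _) ⟨ht, hmem x hx⟩).trans (le_max_left _ _)
  refine ⟨(max B 0).toNNReal + 2 * K, fun t ht => LipschitzWith.of_dist_le_mul fun x y => ?_⟩
  have hcoe : (((max B 0).toNNReal + 2 * K : ℝ≥0) : ℝ) = max B 0 + 2 * K := by
    simp [Real.coe_toNNReal']
  rw [hcoe]
  have hB0 : 0 ≤ max B 0 := le_max_right _ _
  have hK0 : (0 : ℝ) ≤ K := K.2
  rcases eq_or_ne x 0 with rfl | hx
  · rw [hv0, dist_zero_left, dist_zero_left]
    refine (hbd t ht y).trans ?_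
    gcongr
    linarith
  rcases eq_or_ne y 0 with rfl | hy
  · rw [hv0, dist_zero_right, dist_zero_right]
    refine (hbd t ht x).trans ?_
    gcongr
    linarith
  have hx' := norm_pos_iff.2 hx
  have hy' := norm_pos_iff.2 hy
  have h1 : dist (v t (‖x‖⁻¹ • x)) (v t (‖y‖⁻¹ • y)) ≤ K * dist (‖x‖⁻¹ • x) (‖y‖⁻¹ • y) := by
    have := hK.dist_le_mul (t, ‖x‖⁻¹ • x) ⟨ht, hmem x hx⟩ (t, ‖y‖⁻¹ • y) ⟨ht, hmem y hy⟩
    simpa [Function.uncurry, Prod.dist_eq] using this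
  have h2 : ‖y‖ * dist (‖x‖⁻¹ • x) (‖y‖⁻¹ • y) ≤ 2 * dist x y := by
    have e1 : ‖y‖ * dist (‖x‖⁻¹ • x) (‖y‖⁻¹ • y) = ‖((‖y‖ - ‖x‖) * ‖x‖⁻¹) • x + (x - y)‖ := by
      rw [dist_eq_norm, ← norm_norm y, ← norm_smul, norm_norm, smul_sub, smul_smul, smul_smul,
        mul_inv_cancel₀ hy'.ne', sub_mul, mul_inv_cancel₀ hx'.ne', sub_smul, one_smul]
      congr 1
      simp
    rw [e1]
    refine (norm_add_le _ _).trans ?_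
    rw [norm_smul, norm_mul, norm_inv, norm_norm, mul_assoc, inv_mul_cancel₀ hx'.ne', mul_one,
      dist_eq_norm]
    have := abs_norm_sub_norm_le y x
    rw [Real.norm_eq_abs, norm_sub_rev x y] at *
    linarith
  have h3 : ‖v t (‖x‖⁻¹ • x)‖ ≤ max B 0 := (hB (t, _) ⟨ht, hmem x hx⟩).trans (le_max_left _ _)
  have e2 : v t x - v t y = (‖x‖ - ‖y‖) • v t (‖x‖⁻¹ • x) +
      ‖y‖ • (v t (‖x‖⁻¹ • x) - v t (‖y‖⁻¹ • y)) := by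
    rw [hscale t x, hscale t y]
    module
  rw [dist_eq_norm, e2]
  refine (norm_add_le _ _).trans ?_
  rw [norm_smul, norm_smul, norm_norm, ← dist_eq_norm (v t _) (v t _), add_mul]
  have h4 : ‖‖x‖ - ‖y‖‖ ≤ dist x y := by
    rw [dist_eq_norm]
    exact abs_norm_sub_norm_le x y
  refine add_le_add ?_ ?_
  · rw [mul_comm]
    gcongr
  · calc ‖y‖ * dist (v t (‖x‖⁻¹ • x)) (v t (‖y‖⁻¹ • y))
        ≤ ‖y‖ * (K * dist (‖x‖⁻¹ • x) (‖y‖⁻¹ • y)) := by gcongr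
      _ = K * (‖y‖ * dist (‖x‖⁻¹ • x) (‖y‖⁻¹ • y)) := by ring
      _ ≤ K * (2 * dist x y) := by gcongr
      _ = 2 * K * dist x y := by ring

end Lipschitz

section Flow

open Set
open scoped NNReal

variable {E : Type*} [NormedAddCommGroup E] [NormedSpace ℝ E]

/-- `α` solves the differential equation `α' = v t α` on `[a, b]`. -/
def IsSolution (v : ℝ → E → E) (a b : ℝ) (α : ℝ → E) : Prop :=
  ∀ t ∈ Icc a b, HasDerivWithinAt α (v t (α t)) (Icc a b) t

variable {v : ℝ → E → E} {a b : ℝ} {K : ℝ≥0} {α β : ℝ → E}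

lemma IsSolution.continuousOn (h : IsSolution v a b α) : ContinuousOn α (Icc a b) :=
  fun t ht => (h t ht).continuousWithinAt

lemma IsSolution.comp_neg (h : IsSolution v a b α) :
    IsSolution (fun t x => -v (-t) x) (-b) (-a) (fun t => α (-t)) := by
  intro t ht
  have hmaps : MapsTo Neg.neg (Icc (-b) (-a)) (Icc a b) :=
    fun _ hs => ⟨le_neg.mp hs.2, neg_le.mp hs.1⟩
  have := (h (-t) (hmaps ht)).scomp t (hasDerivAt_neg t).hasDerivWithinAt hmaps
  simpa [Function.comp_def] using this

lemma IsSolution.dist_le_of_le (hv : ∀ t ∈ Icc a b, LipschitzWith K (v t))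
    (hα : IsSolution v a b α) (hβ : IsSolution v a b β) {s t : ℝ} (hs : s ∈ Icc a b)
    (ht : t ∈ Icc a b) (hst : s ≤ t) :
    dist (α t) (β t) ≤ dist (α s) (β s) * Real.exp (K * (t - s)) := by
  have hsub : Icc s b ⊆ Icc a b := Icc_subset_Icc_left hs.1
  have hd : ∀ {γ : ℝ → E}, IsSolution v a b γ →
      ∀ t ∈ Ico s b, HasDerivWithinAt γ (v t (γ t)) (Ici t) t := by
    intro γ hγ t ht
    have h1 := hγ t (hsub ⟨ht.1, ht.2.le⟩)
    exact (h1.mono (Icc_subset_Icc_left (hs.1.trans ht.1))).mono_of_mem_nhdsWithin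
      (Icc_mem_nhdsGE ht.2)
  exact dist_le_of_trajectories_ODE_of_mem (s := fun _ => univ)
    (fun t ht => (hv t (hsub ⟨ht.1, ht.2.le⟩)).lipschitzOnWith) (hα.continuousOn.mono hsub)
    (hd hα) (fun _ _ => trivial) (hβ.continuousOn.mono hsub) (hd hβ) (fun _ _ => trivial) le_rfl
    t ⟨hst, ht.2⟩

lemma IsSolution.dist_le (hv : ∀ t ∈ Icc a b, LipschitzWith K (v t))
    (hα : IsSolution v a b α) (hβ : IsSolution v a b β) {s t : ℝ} (hs : s ∈ Icc a b)
    (ht : t ∈ Icc a b) :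
    dist (α t) (β t) ≤ Real.exp (K * (b - a)) * dist (α s) (β s) := by
  have hK : (0 : ℝ) ≤ K := K.2
  have key : ∀ {r : ℝ}, r ≤ b - a → dist (α t) (β t) ≤ dist (α s) (β s) * Real.exp (K * r) →
      dist (α t) (β t) ≤ Real.exp (K * (b - a)) * dist (α s) (β s) := by
    intro r hr h
    rw [mul_comm]
    refine h.trans ?_
    gcongr
  rcases le_total s t with hst | hst
  · exact key (by linarith [hs.1, ht.2]) (hα.dist_le_of_le hv hβ hs ht hst)
  · have hv' : ∀ t ∈ Icc (-b) (-a), LipschitzWith K fun x => -v (-t) x := by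
      intro t ht
      have := (hv (-t) ⟨le_neg.mp ht.2, neg_le.mp ht.1⟩)
      rw [← one_mul K]
      exact LipschitzWith.id.neg.comp this
    have := hα.comp_neg.dist_le_of_le hv' hβ.comp_neg (s := -s) (t := -t)
      ⟨neg_le_neg hs.2, neg_le_neg hs.1⟩ ⟨neg_le_neg ht.2, neg_le_neg ht.1⟩ (neg_le_neg hst)
    simp only [neg_neg] at this
    exact key (by linarith [hs.2, ht.1]) this

lemma IsSolution.eq_of_eq (hv : ∀ t ∈ Icc a b, LipschitzWith K (v t))
    (hα : IsSolution v a b α) (hβ : IsSolution v a b β) {s t : ℝ} (hs : s ∈ Icc a b)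
    (ht : t ∈ Icc a b) (h : α s = β s) : α t = β t := by
  have := hα.dist_le hv hβ hs ht
  rw [h, dist_self, mul_zero] at this
  exact dist_le_zero.1 this

lemma exists_isSolution [CompleteSpace E] (hv : ∀ t ∈ Icc a b, LipschitzWith K (v t))
    (hvc : ∀ x, ContinuousOn (fun t => v t x) (Icc a b)) (hv0 : ∀ t, v t 0 = 0)
    (hK : K * (b - a) ≤ 1 / 2) {s : ℝ} (hs : s ∈ Icc a b) (x : E) :
    ∃ α, α s = x ∧ IsSolution v a b α := by
  have : IsPicardLindelof v (⟨s, hs⟩ : Icc a b) x ‖x‖₊ 0 (2 * K * ‖x‖₊) K := by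
    refine ⟨fun t ht => (hv t ht).lipschitzOnWith, fun x _ => hvc x, fun t ht y hy => ?_, ?_⟩
    · have h1 := (hv t ht).dist_le_mul y 0
      rw [hv0, dist_zero_right, dist_zero_right] at h1
      have h2 : ‖y‖ ≤ 2 * ‖x‖ := by
        have := norm_le_norm_add_norm_sub x y
        rw [Metric.mem_closedBall, dist_eq_norm, norm_sub_rev, coe_nnnorm] at hy
        linarith
      push_cast
      have hK0 : (0 : ℝ) ≤ K := K.2
      nlinarith
    · have h1 : max (b - s) (s - a) ≤ b - a := max_le (by linarith [hs.1]) (by linarith [hs.2])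
      push_cast
      rw [sub_zero]
      have hK0 : (0 : ℝ) ≤ K := K.2
      have h2 : K * max (b - s) (s - a) ≤ 1 / 2 := (mul_le_mul_of_nonneg_left h1 hK0).trans hK
      nlinarith [norm_nonneg x]
  exact this.exists_eq_forall_mem_Icc_hasDerivWithinAt₀

end Flow

section AmbIso

open Set

/-- `X` is carried onto `Y` by an ambient isotopy of projective space. -/
def AmbIso (n : ℕ) (X Y : Set (ProjSp n)) : Prop :=
  ∃ F : Icc (0 : ℝ) 1 × ProjSp n → ProjSp n, Continuous F ∧
    (∀ x, F (⟨0, left_mem_Icc.mpr zero_le_one⟩, x) = x) ∧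
    (∀ t : Icc (0 : ℝ) 1, IsHomeomorph fun x => F (t, x)) ∧
    (fun x => F (⟨1, right_mem_Icc.mpr zero_le_one⟩, x)) '' X = Y

variable {n : ℕ} {X Y Z : Set (ProjSp n)}

lemma AmbIso.refl (X : Set (ProjSp n)) : AmbIso n X X :=
  ⟨Prod.snd, continuous_snd, fun _ => rfl, fun _ => IsHomeomorph.id, image_id X⟩

lemma AmbIso.trans (h : AmbIso n X Y) (h' : AmbIso n Y Z) : AmbIso n X Z := by
  obtain ⟨F, hF, hF0, hFh, rfl⟩ := h
  obtain ⟨F', hF', hF0', hFh', rfl⟩ := h'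
  refine ⟨fun p => F' (p.1, F p), hF'.comp (continuous_fst.prodMk hF), fun x => ?_,
    fun t => (hFh' t).comp (hFh t), ?_⟩
  · simp only [hF0, hF0']
  · rw [image_image]

lemma isOpenQuotientMap_mk (n : ℕ) : IsOpenQuotientMap (Quotient.mk (projSetoid n)) := by
  refine ⟨Quotient.mk_surjective, continuous_quot_mk, fun V hV => ?_⟩
  have key : Quotient.mk (projSetoid n) ⁻¹' (Quotient.mk (projSetoid n) '' V) =
      ⋃ c : ℂˣ, (fun v : NZ n => (⟨(c : ℂ) • v.1, smul_ne_zero c.ne_zero v.2⟩ : NZ n)) ⁻¹' V := by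
    ext v
    simp only [mem_preimage, mem_image, mem_iUnion]
    constructor
    · rintro ⟨w, hw, hwv⟩
      obtain ⟨c, hc, h⟩ := (projSetoid n).symm (Quotient.exact hwv)
      refine ⟨Units.mk0 c hc, ?_⟩
      have : (⟨c • v.1, smul_ne_zero hc v.2⟩ : NZ n) = w := Subtype.ext h
      simpa [this] using hw
    · rintro ⟨c, hc⟩
      exact ⟨_, hc, Quotient.sound ((projSetoid n).symm ⟨c, c.ne_zero, rfl⟩)⟩
  change IsOpen (Quotient.mk (projSetoid n) ⁻¹' (Quotient.mk (projSetoid n) '' V))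
  rw [key]
  exact isOpen_iUnion fun c => hV.preimage (by fun_prop)

/-- A `ℂ`-homogeneous isotopy of the affine space descends to projective space. -/
lemma AmbIso.of_lift {k : ℕ} {P Q : Fin k → MvPolynomial (Fin (n + 1)) ℂ}
    (φ χ : Icc (0 : ℝ) 1 → (Fin (n + 1) → ℂ) → Fin (n + 1) → ℂ)
    (hφ : Continuous (Function.uncurry φ)) (hχ : ∀ t, Continuous (χ t))
    (hφχ : ∀ t x, φ t (χ t x) = x) (hχφ : ∀ t x, χ t (φ t x) = x)
    (hsmul : ∀ t (c : ℂ) x, φ t (c • x) = c • φ t x)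
    (h0 : ∀ x, φ ⟨0, left_mem_Icc.mpr zero_le_one⟩ x = x)
    (h1 : ∀ x ≠ 0, (∀ i, eval x (P i) = 0) ↔
      ∀ i, eval (φ ⟨1, right_mem_Icc.mpr zero_le_one⟩ x) (Q i) = 0) :
    AmbIso n (zeroLocus n k P) (zeroLocus n k Q) := by
  have hsmulχ : ∀ t (c : ℂ) x, χ t (c • x) = c • χ t x := fun t c x => by
    conv_lhs => rw [← hφχ t x, ← hsmul, hχφ]
  have hφ0 : ∀ t, φ t 0 = 0 := fun t => by simpa using hsmul t 0 0
  have hχ0 : ∀ t, χ t 0 = 0 := fun t => by simpa using hsmulχ t 0 0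
  have hφne : ∀ t x, x ≠ 0 → φ t x ≠ 0 := fun t x hx h => hx <| by rw [← hχφ t x, h, hχ0]
  have hχne : ∀ t x, x ≠ 0 → χ t x ≠ 0 := fun t x hx h => hx <| by rw [← hφχ t x, h, hφ0]
  have hq := isOpenQuotientMap_mk n
  let f : Icc (0 : ℝ) 1 → ProjSp n → ProjSp n := fun t =>
    Quotient.map (fun v : NZ n => (⟨φ t v.1, hφne t _ v.2⟩ : NZ n))
      fun v w ⟨c, hc, h⟩ => ⟨c, hc, by rw [← hsmul, h]⟩
  let g : Icc (0 : ℝ) 1 → ProjSp n → ProjSp n := fun t =>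
    Quotient.map (fun v : NZ n => (⟨χ t v.1, hχne t _ v.2⟩ : NZ n))
      fun v w ⟨c, hc, h⟩ => ⟨c, hc, by rw [← hsmulχ, h]⟩
  have hf : Continuous fun p : Icc (0 : ℝ) 1 × ProjSp n => f p.1 p.2 := by
    rw [(IsOpenQuotientMap.id.prodMap hq).isQuotientMap.continuous_iff]
    refine continuous_quot_mk.comp (f := fun p : Icc (0 : ℝ) 1 × NZ n =>
      (⟨φ p.1 p.2.1, hφne _ _ p.2.2⟩ : NZ n)) (Continuous.subtype_mk ?_ _)
    exact hφ.comp (continuous_fst.prodMk (continuous_subtype_val.comp continuous_snd))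
  have hg : ∀ t, Continuous (g t) := fun t => by
    rw [hq.isQuotientMap.continuous_iff]
    refine continuous_quot_mk.comp (f := fun p : NZ n =>
      (⟨χ t p.1, hχne _ _ p.2⟩ : NZ n)) (Continuous.subtype_mk ?_ _)
    exact (hχ t).comp continuous_subtype_val
  refine ⟨fun p => f p.1 p.2, hf, fun x => ?_, fun t => ?_, ?_⟩
  · induction x using Quotient.inductionOn with | _ v =>
    exact congrArg _ (Subtype.ext (h0 v.1))
  · refine (Homeomorph.mk ⟨f t, g t, fun x => ?_, fun x => ?_⟩
      (hf.comp (continuous_const.prodMk continuous_id)) (hg t)).isHomeomorph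
    · induction x using Quotient.inductionOn with | _ v =>
      exact congrArg _ (Subtype.ext (hχφ t v.1))
    · induction x using Quotient.inductionOn with | _ v =>
      exact congrArg _ (Subtype.ext (hφχ t v.1))
  · ext x
    constructor
    · rintro ⟨_, ⟨v, rfl, hv⟩, rfl⟩
      exact ⟨_, rfl, (h1 v.1 v.2).1 hv⟩
    · rintro ⟨w, rfl, hw⟩
      refine ⟨_, ⟨⟨χ ⟨1, right_mem_Icc.mpr zero_le_one⟩ w.1, hχne _ _ w.2⟩, rfl, ?_⟩, ?_⟩
      · rw [h1 _ (hχne _ _ w.2), hφχ]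
        exact hw
      · exact congrArg _ (Subtype.ext (hφχ _ w.1))

/-- The flow of a `ℂ`-homogeneous Lipschitz vector field gives an ambient isotopy. -/
lemma AmbIso.of_vectorField {k : ℕ} {P Q : Fin k → MvPolynomial (Fin (n + 1)) ℂ}
    {v : ℝ → (Fin (n + 1) → ℂ) → Fin (n + 1) → ℂ} {a b : ℝ} {K : NNReal} (hab : a ≤ b)
    (hv : ∀ t ∈ Icc a b, LipschitzWith K (v t))
    (hvc : ∀ x, ContinuousOn (fun t => v t x) (Icc a b))
    (hsmul : ∀ t (c : ℂ) x, v t (c • x) = c • v t x)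
    (hK : K * (b - a) ≤ 1 / 2)
    (h : ∀ α, IsSolution v a b α → (∀ t ∈ Icc a b, α t ≠ 0) →
      ((∀ i, eval (α a) (P i) = 0) ↔ ∀ i, eval (α b) (Q i) = 0)) :
    AmbIso n (zeroLocus n k P) (zeroLocus n k Q) := by
  have hv0 : ∀ t, v t 0 = 0 := fun t => by simpa using hsmul t 0 0
  have hex := fun (s : Icc a b) x => exists_isSolution hv hvc hv0 hK s.2 x
  choose Φ hΦs hΦ using hex
  have huniq : ∀ (s t : Icc a b) x α, IsSolution v a b α → α s = x → Φ s x t = α t :=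
    fun s t x α hα hx => (hΦ s x).eq_of_eq hv hα s.2 t.2 ((hΦs s x).trans hx.symm)
  have hinv : ∀ (s t : Icc a b) x, Φ s (Φ t x s) t = x := fun s t x =>
    (huniq s t _ _ (hΦ t x) rfl).trans (hΦs t x)
  have hΦsmul : ∀ (s t : Icc a b) (c : ℂ) x, Φ s (c • x) t = c • Φ s x t := fun s t c x => by
    refine huniq s t _ (fun t => c • Φ s x t) (fun t ht => ?_) (by rw [hΦs])
    rw [hsmul]
    exact (hΦ s x t ht).const_smul c
  have hΦ0 : ∀ s t : Icc a b, Φ s 0 t = 0 := fun s t => by simpa using hΦsmul s t 0 0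
  have hlip : ∀ s t : Icc a b,
      LipschitzWith (Real.exp (K * (b - a))).toNNReal (fun x => Φ s x t) := fun s t => by
    refine LipschitzWith.of_dist_le_mul fun x y => ?_
    rw [Real.coe_toNNReal _ (Real.exp_pos _).le]
    simpa only [hΦs] using (hΦ s x).dist_le hv (hΦ s y) s.2 t.2
  let A : Icc a b := ⟨a, left_mem_Icc.2 hab⟩
  let T : Icc (0 : ℝ) 1 → Icc a b := fun τ => ⟨a + τ * (b - a),
    by nlinarith [τ.2.1], by nlinarith [τ.2.2]⟩
  have hT : Continuous T := by fun_prop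
  refine AmbIso.of_lift (fun τ x => Φ A x (T τ)) (fun τ x => Φ (T τ) x A) ?_
    (fun t => (hlip _ _).continuous) (fun t x => hinv _ _ _) (fun t x => hinv _ _ _)
    (fun t c x => hΦsmul _ _ _ _) (fun x => ?_) (fun x hx => ?_)
  · refine continuous_prod_of_continuous_lipschitzWith' _ _ (fun τ => hlip A (T τ)) fun x => ?_
    exact (hΦ A x).continuousOn.comp_continuous (continuous_subtype_val.comp hT) fun τ => (T τ).2
  · simpa [T] using hΦs A x
  · have := h _ (hΦ A x) fun t ht h0 => hx ?_
    · rw [show Φ A x a = x from hΦs A x] at this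
      simpa [T] using this
    · rw [← hinv ⟨t, ht⟩ A x]
      exact (congrArg (fun y => Φ ⟨t, ht⟩ y A) h0).trans (hΦ0 _ _)

end AmbIso

section LiftField

open Matrix
open scoped ComplexOrder

variable {m k : ℕ}

/-- The Jacobian matrix of a tuple of polynomials. -/
noncomputable def jac (P : Fin k → MvPolynomial (Fin m) ℂ) (x : Fin m → ℂ) :
    Matrix (Fin k) (Fin m) ℂ :=
  of fun i j => eval x (pderiv j (P i))

/-- The squared Hermitian norm. -/
noncomputable def normSq (x : Fin m → ℂ) : ℝ := ∑ j, ‖x j‖ ^ 2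

/-- A function on projective space vanishing exactly on the common zeros of the `P i`. -/
noncomputable def defect (d : Fin k → ℕ) (P : Fin k → MvPolynomial (Fin m) ℂ) (x : Fin m → ℂ) :
    ℝ :=
  ∑ i, ‖eval x (P i)‖ ^ 2 / normSq x ^ d i

/-- The Gram matrix of the Jacobian, regularised away from the common zeros. -/
noncomputable def regGram (d : Fin k → ℕ) (P : Fin k → MvPolynomial (Fin m) ℂ)
    (x : Fin m → ℂ) : Matrix (Fin k) (Fin k) ℂ :=
  jac P x * (jac P x)ᴴ + diagonal fun i => ((defect d P x * normSq x ^ (d i - 1) : ℝ) : ℂ)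

/-- The coefficients of `liftField` in terms of the conjugated gradients. -/
noncomputable def liftCoeff (d : Fin k → ℕ) (P Q : Fin k → MvPolynomial (Fin m) ℂ)
    (x : Fin m → ℂ) : Fin k → ℂ :=
  (regGram d P x)⁻¹ *ᵥ fun i => eval x (Q i)

/-- A vector field along which the `P i` vary, near their common zeros, like `-Q i`. -/
noncomputable def liftField (d : Fin k → ℕ) (P Q : Fin k → MvPolynomial (Fin m) ℂ)
    (x : Fin m → ℂ) : Fin m → ℂ :=
  -((jac P x)ᴴ *ᵥ liftCoeff d P Q x)

lemma normSq_pos {x : Fin m → ℂ} (hx : x ≠ 0) : 0 < normSq x := by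
  obtain ⟨j, hj⟩ := Function.ne_iff.1 hx
  exact Finset.sum_pos' (fun _ _ => by positivity) ⟨j, Finset.mem_univ _, by
    have := norm_pos_iff.2 hj
    positivity⟩

lemma normSq_smul (c : ℂ) (x : Fin m → ℂ) : normSq (c • x) = ‖c‖ ^ 2 * normSq x := by
  simp [normSq, mul_pow, Finset.mul_sum]

lemma defect_nonneg (d : Fin k → ℕ) (P : Fin k → MvPolynomial (Fin m) ℂ) (x : Fin m → ℂ) :
    0 ≤ defect d P x :=
  Finset.sum_nonneg fun _ _ => div_nonneg (by positivity)
    (pow_nonneg (Finset.sum_nonneg fun _ _ => by positivity) _)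

lemma eval_smul_of_isHomogeneous {p : MvPolynomial (Fin m) ℂ} {e : ℕ} (hp : p.IsHomogeneous e)
    (c : ℂ) (x : Fin m → ℂ) : eval (c • x) p = c ^ e * eval x p := by
  rw [eval_eq, eval_eq, Finset.mul_sum]
  refine Finset.sum_congr rfl fun s hs => ?_
  have hdeg : ∑ i ∈ s.support, s i = e := by
    have := hp (mem_support_iff.1 hs)
    rwa [Finsupp.weight_apply, Finsupp.sum, Finset.sum_congr rfl (g := fun i => s i)] at this
    simp
  simp only [Pi.smul_apply, smul_eq_mul, mul_pow, Finset.prod_mul_distrib, Finset.prod_pow_eq_pow_sum,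
    hdeg]
  ring

lemma defect_smul {d : Fin k → ℕ} {P : Fin k → MvPolynomial (Fin m) ℂ}
    (hP : ∀ i, (P i).IsHomogeneous (d i)) {c : ℂ} (hc : c ≠ 0) (x : Fin m → ℂ) :
    defect d P (c • x) = defect d P x := by
  refine Finset.sum_congr rfl fun i _ => ?_
  have := norm_ne_zero_iff.2 hc
  rw [eval_smul_of_isHomogeneous (hP i), normSq_smul, norm_mul, norm_pow, mul_pow, mul_pow,
    ← pow_mul, ← pow_mul, mul_comm (d i), mul_div_mul_left _ _ (by positivity)]

lemma jac_smul {d : Fin k → ℕ} {P : Fin k → MvPolynomial (Fin m) ℂ}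
    (hP : ∀ i, (P i).IsHomogeneous (d i)) (c : ℂ) (x : Fin m → ℂ) :
    jac P (c • x) = diagonal (fun i => c ^ (d i - 1)) * jac P x := by
  ext i j
  rw [diagonal_mul]
  exact eval_smul_of_isHomogeneous (hP i).pderiv c x

lemma regGram_smul {d : Fin k → ℕ} {P : Fin k → MvPolynomial (Fin m) ℂ}
    (hP : ∀ i, (P i).IsHomogeneous (d i)) {c : ℂ} (hc : c ≠ 0) (x : Fin m → ℂ) :
    regGram d P (c • x) = diagonal (fun i => c ^ (d i - 1)) * regGram d P x *
      (diagonal fun i => c ^ (d i - 1))ᴴ := by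
  rw [regGram, regGram, jac_smul hP, defect_smul hP hc, conjTranspose_mul, mul_add, add_mul]
  congr 1
  · simp only [Matrix.mul_assoc]
  · rw [diagonal_conjTranspose, diagonal_mul_diagonal, diagonal_mul_diagonal]
    congr 1
    ext i
    have h : ((‖c‖ : ℂ)) ^ 2 = c * star c := by
      rw [Complex.star_def, Complex.mul_conj, Complex.normSq_eq_norm_sq]
      push_cast
      rfl
    rw [normSq_smul]
    push_cast
    rw [h]
    simp only [Pi.star_apply, star_pow]
    ring

lemma det_regGram_ne_zero {n : ℕ} {d : Fin k → ℕ} {P : Fin k → MvPolynomial (Fin (n + 1)) ℂ}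
    (hP : IsSmoothCI n k P d) {x : Fin (n + 1) → ℂ} (hx : x ≠ 0) : (regGram d P x).det ≠ 0 := by
  have hN := normSq_pos hx
  rcases (defect_nonneg d P x).eq_or_lt with h0 | h0
  · have hz : ∀ i, eval x (P i) = 0 := by
      intro i
      have h1 := (Finset.sum_eq_zero_iff_of_nonneg fun i _ => by positivity).1 h0.symm i
        (Finset.mem_univ i)
      have h2 := (div_eq_zero_iff.1 h1).resolve_right (by positivity)
      simpa using h2
    have hr := hP.2 x hx hz
    have : regGram d P x = jac P x * (jac P x)ᴴ := by simp [regGram, ← h0]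
    rw [this, ← isUnit_iff_ne_zero, ← Matrix.isUnit_iff_isUnit_det,
      ← linearIndependent_cols_iff_isUnit, linearIndependent_iff_card_eq_finrank_span,
      Set.finrank, ← rank_eq_finrank_span_cols, rank_self_mul_conjTranspose, Fintype.card_fin]
    exact hr.symm
  · refine (Matrix.PosDef.posSemidef_add (posSemidef_self_mul_conjTranspose _)
      (PosDef.diagonal fun i => ?_)).det_pos.ne'
    have : 0 < defect d P x * normSq x ^ (d i - 1) := by positivity
    exact_mod_cast this

lemma regGram_mulVec_liftCoeff {n : ℕ} {d : Fin k → ℕ}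
    {P : Fin k → MvPolynomial (Fin (n + 1)) ℂ} (hP : IsSmoothCI n k P d)
    (Q : Fin k → MvPolynomial (Fin (n + 1)) ℂ) {x : Fin (n + 1) → ℂ} (hx : x ≠ 0) :
    regGram d P x *ᵥ liftCoeff d P Q x = fun i => eval x (Q i) := by
  rw [liftCoeff, mulVec_mulVec, mul_nonsing_inv _ (det_regGram_ne_zero hP hx).isUnit, one_mulVec]

lemma eq_liftCoeff {n : ℕ} {d : Fin k → ℕ}
    {P : Fin k → MvPolynomial (Fin (n + 1)) ℂ} (hP : IsSmoothCI n k P d)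
    {Q : Fin k → MvPolynomial (Fin (n + 1)) ℂ} {x : Fin (n + 1) → ℂ} (hx : x ≠ 0) {w : Fin k → ℂ}
    (hw : regGram d P x *ᵥ w = fun i => eval x (Q i)) : w = liftCoeff d P Q x := by
  rw [liftCoeff, ← hw, mulVec_mulVec, nonsing_inv_mul _ (det_regGram_ne_zero hP hx).isUnit,
    one_mulVec]

lemma liftField_zero {n : ℕ} {d : Fin k → ℕ} (hd : ∀ i, 1 ≤ d i)
    (P : Fin k → MvPolynomial (Fin (n + 1)) ℂ) {Q : Fin k → MvPolynomial (Fin (n + 1)) ℂ}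
    (hQ : ∀ i, (Q i).IsHomogeneous (d i)) : liftField d P Q 0 = 0 := by
  have : (fun i => eval (0 : Fin (n + 1) → ℂ) (Q i)) = 0 := by
    ext i
    have := eval_smul_of_isHomogeneous (hQ i) 0 0
    rwa [zero_smul, zero_pow (by have := hd i; omega), zero_mul] at this
  rw [liftField, liftCoeff, this, mulVec_zero, mulVec_zero, neg_zero]

lemma liftField_smul {n : ℕ} {d : Fin k → ℕ} (hd : ∀ i, 1 ≤ d i)
    {P : Fin k → MvPolynomial (Fin (n + 1)) ℂ} (hP : IsSmoothCI n k P d)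
    {Q : Fin k → MvPolynomial (Fin (n + 1)) ℂ}
    (hQ : ∀ i, (Q i).IsHomogeneous (d i)) (c : ℂ) (x : Fin (n + 1) → ℂ) :
    liftField d P Q (c • x) = c • liftField d P Q x := by
  rcases eq_or_ne c 0 with rfl | hc
  · simp [liftField_zero hd P hQ]
  rcases eq_or_ne x 0 with rfl | hx
  · simp [liftField_zero hd P hQ]
  let D : Matrix (Fin k) (Fin k) ℂ := diagonal fun i => c ^ (d i - 1)
  have hD : IsUnit Dᴴ.det := by
    rw [det_conjTranspose, det_diagonal, isUnit_iff_ne_zero]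
    exact star_ne_zero.2 (Finset.prod_ne_zero_iff.2 fun i _ => pow_ne_zero _ hc)
  have hw : c • (Dᴴ⁻¹ *ᵥ liftCoeff d P Q x) = liftCoeff d P Q (c • x) := by
    refine eq_liftCoeff hP (smul_ne_zero hc hx) ?_
    rw [regGram_smul hP.1 hc, mulVec_smul, mulVec_mulVec, Matrix.mul_assoc,
      mul_nonsing_inv _ hD, Matrix.mul_one, ← mulVec_mulVec, regGram_mulVec_liftCoeff hP Q hx]
    ext i
    rw [eval_smul_of_isHomogeneous (hQ i), Pi.smul_apply, mulVec_diagonal, smul_eq_mul,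
      ← mul_assoc, ← pow_succ', Nat.sub_add_cancel (hd i)]
  rw [liftField, liftField, jac_smul hP.1, ← hw, conjTranspose_mul, mulVec_smul, ← mulVec_mulVec,
    mulVec_mulVec _ Dᴴ, mul_nonsing_inv _ hD, one_mulVec, smul_neg]

/-- The deviation of the derivative of `P` along `liftField` from `-Q`. -/
lemma add_jac_mulVec_liftField {n : ℕ} {d : Fin k → ℕ}
    {P : Fin k → MvPolynomial (Fin (n + 1)) ℂ} (hP : IsSmoothCI n k P d)
    (Q : Fin k → MvPolynomial (Fin (n + 1)) ℂ) {x : Fin (n + 1) → ℂ} (hx : x ≠ 0) (i : Fin k) :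
    eval x (Q i) + (jac P x *ᵥ liftField d P Q x) i =
      ((defect d P x * normSq x ^ (d i - 1) : ℝ) : ℂ) * liftCoeff d P Q x i := by
  have := congrFun (regGram_mulVec_liftCoeff hP Q hx) i

  rw [← this, regGram, add_mulVec, Pi.add_apply, mulVec_diagonal, liftField, mulVec_neg,
    mulVec_mulVec, Pi.neg_apply]
  ring

end LiftField

section Smoothness

open Matrix

variable {X : Type*} [NormedAddCommGroup X] [NormedSpace ℝ X] {m k : ℕ} {p : X}

lemma contDiffAt_eval {r : WithTop ℕ∞} {x : X → Fin m → ℂ} (hx : ContDiffAt ℝ r x p)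
    (q : MvPolynomial (Fin m) ℂ) : ContDiffAt ℝ r (fun y => eval (x y) q) p := by
  induction q using MvPolynomial.induction_on with
  | C a => simpa only [eval_C] using contDiffAt_const
  | add q q' h h' => simpa only [map_add] using h.add h'
  | mul_X q j h => simpa only [map_mul, eval_X] using h.mul (contDiffAt_pi.1 hx j)

lemma contDiffAt_det {r : WithTop ℕ∞} {A : X → Matrix (Fin k) (Fin k) ℂ}
    (hA : ∀ i j, ContDiffAt ℝ r (fun y => A y i j) p) :
    ContDiffAt ℝ r (fun y => (A y).det) p := by
  simp only [det_apply']
  exact ContDiffAt.sum fun σ _ => contDiffAt_const.mul (contDiffAt_prod fun i _ => hA _ _)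

lemma contDiffAt_inv_mulVec {r : WithTop ℕ∞} {A : X → Matrix (Fin k) (Fin k) ℂ}
    {b : X → Fin k → ℂ} (hA : ∀ i j, ContDiffAt ℝ r (fun y => A y i j) p)
    (hb : ∀ i, ContDiffAt ℝ r (fun y => b y i) p) (hdet : (A p).det ≠ 0) (i : Fin k) :
    ContDiffAt ℝ r (fun y => ((A y)⁻¹ *ᵥ b y) i) p := by
  have : ∀ y, ((A y)⁻¹ *ᵥ b y) i = ((A y).det)⁻¹ * ((A y).updateCol i (b y)).det := fun y => by
    rw [Matrix.inv_def, smul_mulVec, ← cramer_eq_adjugate_mulVec, Pi.smul_apply, cramer_apply,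
      Ring.inverse_eq_inv', smul_eq_mul]
  simp only [this]
  refine ((contDiffAt_det hA).inv hdet).mul (contDiffAt_det fun l j => ?_)
  simp only [updateCol_apply]
  split_ifs
  exacts [hb l, hA l j]

variable {d : Fin k → ℕ} {P Q : X → Fin k → MvPolynomial (Fin m) ℂ} {x : X → Fin m → ℂ}
  {r : WithTop ℕ∞}

lemma contDiffAt_normSq (hx : ContDiffAt ℝ r x p) : ContDiffAt ℝ r (fun y => normSq (x y)) p :=
  ContDiffAt.sum fun j _ => (contDiffAt_pi.1 hx j).norm_sq ℝ

lemma contDiffAt_defect (hx : ContDiffAt ℝ r x p) (hx0 : x p ≠ 0)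
    (hP : ∀ i, ContDiffAt ℝ r (fun y => eval (x y) (P y i)) p) :
    ContDiffAt ℝ r (fun y => defect d (P y) (x y)) p :=
  ContDiffAt.sum fun i _ => ((hP i).norm_sq ℝ).div ((contDiffAt_normSq hx).pow _)
    (pow_ne_zero _ (normSq_pos hx0).ne')

lemma contDiffAt_regGram (hx : ContDiffAt ℝ r x p) (hx0 : x p ≠ 0)
    (hP : ∀ i, ContDiffAt ℝ r (fun y => eval (x y) (P y i)) p)
    (hJ : ∀ i j, ContDiffAt ℝ r (fun y => jac (P y) (x y) i j) p) (i l : Fin k) :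
    ContDiffAt ℝ r (fun y => regGram d (P y) (x y) i l) p := by
  simp only [regGram, Matrix.add_apply, mul_apply, conjTranspose_apply, diagonal_apply]
  refine (ContDiffAt.sum fun j _ => (hJ i j).mul ?_).add ?_
  · exact Complex.conjCLE.contDiff.contDiffAt.comp p (hJ l j)
  · split_ifs
    · exact Complex.ofRealCLM.contDiff.contDiffAt.comp p
        ((contDiffAt_defect hx hx0 hP).mul ((contDiffAt_normSq hx).pow _))
    · exact contDiffAt_const

lemma contDiffAt_liftCoeff (hx : ContDiffAt ℝ r x p) (hx0 : x p ≠ 0)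
    (hP : ∀ i, ContDiffAt ℝ r (fun y => eval (x y) (P y i)) p)
    (hJ : ∀ i j, ContDiffAt ℝ r (fun y => jac (P y) (x y) i j) p)
    (hQ : ∀ i, ContDiffAt ℝ r (fun y => eval (x y) (Q y i)) p)
    (hdet : (regGram d (P p) (x p)).det ≠ 0) (i : Fin k) :
    ContDiffAt ℝ r (fun y => liftCoeff d (P y) (Q y) (x y) i) p :=
  contDiffAt_inv_mulVec (contDiffAt_regGram hx hx0 hP hJ) hQ hdet i

lemma contDiffAt_liftField (hx : ContDiffAt ℝ r x p) (hx0 : x p ≠ 0)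
    (hP : ∀ i, ContDiffAt ℝ r (fun y => eval (x y) (P y i)) p)
    (hJ : ∀ i j, ContDiffAt ℝ r (fun y => jac (P y) (x y) i j) p)
    (hQ : ∀ i, ContDiffAt ℝ r (fun y => eval (x y) (Q y i)) p)
    (hdet : (regGram d (P p) (x p)).det ≠ 0) :
    ContDiffAt ℝ r (fun y => liftField d (P y) (Q y) (x y)) p := by
  refine contDiffAt_pi.2 fun j => (ContDiffAt.sum fun i _ => ?_).neg
  exact (Complex.conjCLE.contDiff.contDiffAt.comp p (hJ i j)).mul
    (contDiffAt_liftCoeff hx hx0 hP hJ hQ hdet i)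

end Smoothness

section ZeroPreservation

open Set

lemma hasDerivWithinAt_eval {m : ℕ} {x : ℝ → Fin m → ℂ} {x' : Fin m → ℂ} {S : Set ℝ} {t : ℝ}
    (hx : HasDerivWithinAt x x' S t) (q : MvPolynomial (Fin m) ℂ) :
    HasDerivWithinAt (fun t => eval (x t) q) (∑ j, eval (x t) (pderiv j q) * x' j) S t := by
  induction q using MvPolynomial.induction_on with
  | C a => simpa using hasDerivWithinAt_const t S a
  | add q q' h h' =>
    simp only [map_add, add_mul, Finset.sum_add_distrib]
    exact h.add h'
  | mul_X q j h =>
    simp only [map_mul, eval_X, Derivation.leibniz, pderiv_X, smul_eq_mul, map_add, add_mul,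
      Finset.sum_add_distrib]
    refine (h.mul (hasDerivWithinAt_pi.1 hx j)).congr_deriv ?_
    rw [add_comm, Finset.sum_mul]
    congr 1
    · rw [Finset.sum_eq_single j]
      · simp
      · intro i _ hij
        simp [hij.symm]
      · simp
    · exact Finset.sum_congr rfl fun i _ => by ring

variable {F : Type*} [NormedAddCommGroup F] [NormedSpace ℝ F] {a b : ℝ} {y y' : ℝ → F} {κ : ℝ → ℝ}

lemma eq_zero_right_of_norm_deriv_le (hab : a ≤ b)
    (hy : ∀ t ∈ Icc a b, HasDerivWithinAt y (y' t) (Icc a b) t)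
    (hκ : ContinuousOn κ (Icc a b)) (hle : ∀ t ∈ Icc a b, ‖y' t‖ ≤ κ t * ‖y t‖) (ha : y a = 0) :
    y b = 0 := by
  obtain ⟨C, hC⟩ := isCompact_Icc.exists_bound_of_continuousOn hκ
  refine eq_zero_of_abs_deriv_le_mul_abs_self_of_eq_zero_right
    (fun t ht => (hy t ht).continuousWithinAt) (fun t ht => ?_) ha (K := C) (f' := y')
    (fun t ht => ?_) b (right_mem_Icc.2 hab)
  · exact ((hy t ⟨ht.1, ht.2.le⟩).mono (Icc_subset_Icc_left ht.1)).mono_of_mem_nhdsWithin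
      (Icc_mem_nhdsGE ht.2)
  · refine (hle t ⟨ht.1, ht.2.le⟩).trans ?_
    gcongr
    exact (le_abs_self _).trans (hC t ⟨ht.1, ht.2.le⟩)

lemma eq_zero_iff_of_norm_deriv_le (hab : a ≤ b)
    (hy : ∀ t ∈ Icc a b, HasDerivWithinAt y (y' t) (Icc a b) t)
    (hκ : ContinuousOn κ (Icc a b)) (hle : ∀ t ∈ Icc a b, ‖y' t‖ ≤ κ t * ‖y t‖) :
    y a = 0 ↔ y b = 0 := by
  refine ⟨eq_zero_right_of_norm_deriv_le hab hy hκ hle, fun hb => ?_⟩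
  have hmaps : MapsTo Neg.neg (Icc (-b) (-a)) (Icc a b) :=
    fun _ hs => ⟨le_neg.mp hs.2, neg_le.mp hs.1⟩
  have := eq_zero_right_of_norm_deriv_le (y := fun t => y (-t)) (y' := fun t => -y' (-t))
    (κ := fun t => κ (-t)) (neg_le_neg hab) (fun t ht => ?_)
    (hκ.comp continuous_neg.continuousOn hmaps) (fun t ht => ?_) (by simpa using hb)
  · simpa using this
  · simpa [Function.comp_def] using
      (hy (-t) (hmaps ht)).scomp t (hasDerivAt_neg t).hasDerivWithinAt hmaps
  · simpa using hle (-t) (hmaps ht)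

end ZeroPreservation

section PencilFlow

open Set Metric

variable {n k : ℕ} {d : Fin k → ℕ} {G U : Fin k → MvPolynomial (Fin (n + 1)) ℂ} {s s' : ℝ → ℂ}

/-- A vector field whose flow follows the cones over the zero loci of `pencil G U (s t)`. -/
noncomputable def pencilField (d : Fin k → ℕ) (G U : Fin k → MvPolynomial (Fin (n + 1)) ℂ)
    (s s' : ℝ → ℂ) (t : ℝ) : (Fin (n + 1) → ℂ) → Fin (n + 1) → ℂ :=
  liftField d (pencil G U (s t)) fun i => C (s' t) * (U i - G i)

lemma contDiffAt_eval_pencil (hs : ContDiff ℝ 1 s) (p : ℝ × (Fin (n + 1) → ℂ)) (i : Fin k) :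
    ContDiffAt ℝ 1 (fun y : ℝ × (Fin (n + 1) → ℂ) => eval y.2 (pencil G U (s y.1) i)) p := by
  have h1 : ContDiffAt ℝ 1 (fun y : ℝ × (Fin (n + 1) → ℂ) => s y.1) p :=
    hs.contDiffAt.comp p contDiffAt_fst
  simp only [pencil, map_add, map_mul, eval_C]
  exact ((contDiffAt_const.sub h1).mul (contDiffAt_eval contDiffAt_snd _)).add
    (h1.mul (contDiffAt_eval contDiffAt_snd _))

lemma contDiffAt_jac_pencil (hs : ContDiff ℝ 1 s) (p : ℝ × (Fin (n + 1) → ℂ)) (i : Fin k)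
    (j : Fin (n + 1)) :
    ContDiffAt ℝ 1 (fun y : ℝ × (Fin (n + 1) → ℂ) => jac (pencil G U (s y.1)) y.2 i j) p := by
  have h1 : ContDiffAt ℝ 1 (fun y : ℝ × (Fin (n + 1) → ℂ) => s y.1) p :=
    hs.contDiffAt.comp p contDiffAt_fst
  simp only [jac, Matrix.of_apply, pencil, map_add, pderiv_C_mul, map_mul, eval_C]
  exact ((contDiffAt_const.sub h1).mul (contDiffAt_eval contDiffAt_snd _)).add
    (h1.mul (contDiffAt_eval contDiffAt_snd _))

lemma contDiffAt_eval_pencil_deriv (hs' : ContDiff ℝ 1 s') (p : ℝ × (Fin (n + 1) → ℂ))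
    (i : Fin k) :
    ContDiffAt ℝ 1 (fun y : ℝ × (Fin (n + 1) → ℂ) => eval y.2 (C (s' y.1) * (U i - G i))) p := by
  simp only [map_mul, eval_C]
  exact (hs'.contDiffAt.comp p contDiffAt_fst).mul (contDiffAt_eval contDiffAt_snd _)

lemma contDiffAt_pencilCoeff (hs : ContDiff ℝ 1 s) (hs' : ContDiff ℝ 1 s')
    (hgood : ∀ t, IsSmoothCI n k (pencil G U (s t)) d) {p : ℝ × (Fin (n + 1) → ℂ)}
    (hp : p.2 ≠ 0) (i : Fin k) :
    ContDiffAt ℝ 1 (fun y : ℝ × (Fin (n + 1) → ℂ) =>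
      liftCoeff d (pencil G U (s y.1)) (fun i => C (s' y.1) * (U i - G i)) y.2 i) p := by
  have := contDiffAt_liftCoeff (p := p) (r := 1) (d := d) (x := Prod.snd)
    (P := fun y => pencil G U (s y.1))
    (Q := fun y i => C (s' y.1) * (U i - G i)) contDiffAt_snd hp (contDiffAt_eval_pencil hs p)
    (contDiffAt_jac_pencil hs p) (contDiffAt_eval_pencil_deriv hs' p)
    (det_regGram_ne_zero (hgood _) hp) i
  exact this

lemma contDiffAt_pencilField (hs : ContDiff ℝ 1 s) (hs' : ContDiff ℝ 1 s')
    (hgood : ∀ t, IsSmoothCI n k (pencil G U (s t)) d) {p : ℝ × (Fin (n + 1) → ℂ)}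
    (hp : p.2 ≠ 0) :
    ContDiffAt ℝ 1 (Function.uncurry (pencilField d G U s s')) p := by
  have := contDiffAt_liftField (p := p) (r := 1) (d := d) (x := Prod.snd)
    (P := fun y => pencil G U (s y.1))
    (Q := fun y i => C (s' y.1) * (U i - G i)) contDiffAt_snd hp (contDiffAt_eval_pencil hs p)
    (contDiffAt_jac_pencil hs p) (contDiffAt_eval_pencil_deriv hs' p)
    (det_regGram_ne_zero (hgood _) hp)
  exact this

lemma pencilField_smul (hd : ∀ i, 1 ≤ d i) (hG : ∀ i, (G i).IsHomogeneous (d i))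
    (hU : ∀ i, (U i).IsHomogeneous (d i)) (hgood : ∀ t, IsSmoothCI n k (pencil G U (s t)) d)
    (t : ℝ) (c : ℂ) (x : Fin (n + 1) → ℂ) :
    pencilField d G U s s' t (c • x) = c • pencilField d G U s s' t x :=
  liftField_smul hd (hgood t) (fun i => by
    simpa using (isHomogeneous_C _ (s' t)).mul ((hU i).sub (hG i))) c x

lemma hasDerivWithinAt_eval_pencil {α : ℝ → Fin (n + 1) → ℂ} {α' : Fin (n + 1) → ℂ} {S : Set ℝ}
    {t : ℝ} (hα : HasDerivWithinAt α α' S t) (hs : HasDerivAt s (s' t) t) (i : Fin k) :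
    HasDerivWithinAt (fun t => eval (α t) (pencil G U (s t) i))
      (eval (α t) (C (s' t) * (U i - G i)) + (jac (pencil G U (s t)) (α t)).mulVec α' i) S t := by
  have h := (((hs.hasDerivWithinAt (s := S)).const_sub 1).mul (hasDerivWithinAt_eval hα (G i))).add
    ((hs.hasDerivWithinAt (s := S)).mul (hasDerivWithinAt_eval hα (U i)))
  simp only [pencil, map_add, map_mul, eval_C, Matrix.mulVec, dotProduct, jac,
    Matrix.of_apply, pderiv_C_mul]
  refine h.congr_deriv ?_
  simp only [map_sub, add_mul, Finset.sum_add_distrib, mul_assoc, ← Finset.mul_sum]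
  ring

lemma eval_pencil_eq_zero_iff (hs : ContDiff ℝ 1 s) (hs' : ContDiff ℝ 1 s')
    (hds : ∀ t, HasDerivAt s (s' t) t) (hgood : ∀ t, IsSmoothCI n k (pencil G U (s t)) d)
    {a b : ℝ} (hab : a ≤ b) {α : ℝ → Fin (n + 1) → ℂ}
    (hα : IsSolution (pencilField d G U s s') a b α) (hα0 : ∀ t ∈ Icc a b, α t ≠ 0) :
    (∀ i, eval (α a) (pencil G U (s a) i) = 0) ↔ ∀ i, eval (α b) (pencil G U (s b) i) = 0 := by
  let y : ℝ → Fin k → ℂ := fun t i => eval (α t) (pencil G U (s t) i)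
  let w : ℝ → Fin k → ℂ := fun t =>
    liftCoeff d (pencil G U (s t)) (fun i => C (s' t) * (U i - G i)) (α t)
  have hpair : ContinuousOn (fun t => (t, α t)) (Icc a b) :=
    continuousOn_id.prodMk hα.continuousOn
  have hyc : ∀ i, ContinuousOn (fun t => y t i) (Icc a b) := fun i t ht =>
    (contDiffAt_eval_pencil hs (t, α t) i).continuousAt.comp_continuousWithinAt
      (f := fun t => (t, α t)) (hpair t ht)
  have hwc : ∀ i, ContinuousOn (fun t => w t i) (Icc a b) := fun i t ht =>
    (contDiffAt_pencilCoeff hs hs' hgood (p := (t, α t)) (hα0 t ht)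
      i).continuousAt.comp_continuousWithinAt
      (f := fun t => (t, α t)) (hpair t ht)
  have hNc : ContinuousOn (fun t => normSq (α t)) (Icc a b) := by
    refine continuousOn_finsetSum _ fun j _ => ?_
    exact ((continuousOn_pi.1 hα.continuousOn j).norm).pow 2
  have hN : ∀ t ∈ Icc a b, 0 < normSq (α t) := fun t ht => normSq_pos (hα0 t ht)
  have := eq_zero_iff_of_norm_deriv_le (y := y)
    (y' := fun t i => ((defect d (pencil G U (s t)) (α t) * normSq (α t) ^ (d i - 1) : ℝ) : ℂ) *
      w t i)
    (κ := fun t => (∑ i, ‖y t i‖ / normSq (α t) ^ d i) *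
      ∑ i, normSq (α t) ^ (d i - 1) * ‖w t i‖) hab (fun t ht => ?_) ?_ fun t ht => ?_
  · rw [funext_iff, funext_iff] at this
    exact this
  · refine hasDerivWithinAt_pi.2 fun i => ?_
    have h := hasDerivWithinAt_eval_pencil (G := G) (U := U) (hα t ht) (hds t) i
    have e := add_jac_mulVec_liftField (hgood t) (fun i => C (s' t) * (U i - G i)) (hα0 t ht) i
    exact h.congr_deriv e
  · refine ContinuousOn.mul (continuousOn_finsetSum _ fun i _ => ?_)
      (continuousOn_finsetSum _ fun i _ => ?_)
    · exact (hyc i).norm.div (hNc.pow _) fun t ht => (pow_pos (hN t ht) _).ne'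
    · exact (hNc.pow _).mul (hwc i).norm
  · have hNt := hN t ht
    have h1 : defect d (pencil G U (s t)) (α t) ≤
        (∑ i, ‖y t i‖ / normSq (α t) ^ d i) * ‖y t‖ := by
      rw [defect, Finset.sum_mul]
      refine Finset.sum_le_sum fun i _ => ?_
      rw [sq, mul_div_right_comm]
      gcongr
      exact norm_le_pi_norm (y t) i
    have h2 : ∀ i, normSq (α t) ^ (d i - 1) * ‖w t i‖ ≤
        ∑ i, normSq (α t) ^ (d i - 1) * ‖w t i‖ := fun i =>
      Finset.single_le_sum (f := fun i => normSq (α t) ^ (d i - 1) * ‖w t i‖)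
        (fun i _ => by positivity) (Finset.mem_univ i)
    refine (pi_norm_le_iff_of_nonneg (by positivity)).2 fun i => ?_
    rw [norm_mul, Complex.norm_real, Real.norm_of_nonneg
      (mul_nonneg (defect_nonneg _ _ _) (by positivity)), mul_assoc]
    refine (mul_le_mul h1 (h2 i) (by positivity) (by positivity)).trans_eq ?_
    ring

/-- An arc of smooth members of a pencil yields an ambient isotopy between its ends. -/
lemma ambIso_pencil (hd : ∀ i, 1 ≤ d i) (hG : ∀ i, (G i).IsHomogeneous (d i))
    (hU : ∀ i, (U i).IsHomogeneous (d i)) (hs : ContDiff ℝ 1 s) (hs' : ContDiff ℝ 1 s')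
    (hds : ∀ t, HasDerivAt s (s' t) t) (hgood : ∀ t, IsSmoothCI n k (pencil G U (s t)) d) :
    AmbIso n (zeroLocus n k (pencil G U (s 0))) (zeroLocus n k (pencil G U (s 1))) := by
  have hsm := pencilField_smul (s' := s') hd hG hU hgood
  have hv0 : ∀ t, pencilField d G U s s' t 0 = 0 := fun t => by simpa using hsm t 0 0
  obtain ⟨K, hK⟩ := exists_lipschitzWith_of_homogeneous (pencilField d G U s s') (Icc 0 1)
    isCompact_Icc (fun t x r _ => by simpa using hsm t r x) (by
      rintro ⟨t, x⟩ ⟨-, hx⟩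
      obtain ⟨K, T, hT, hK⟩ := (contDiffAt_pencilField hs hs' hgood (p := (t, x))
        (ne_zero_of_mem_unit_sphere ⟨x, hx⟩)).exists_lipschitzOnWith
      exact ⟨K, T, mem_nhdsWithin_of_mem_nhds hT, hK⟩)
  have hcont : ∀ x, Continuous fun t => pencilField d G U s s' t x := fun x => by
    rcases eq_or_ne x 0 with rfl | hx
    · simpa only [hv0] using continuous_const
    · exact continuous_iff_continuousAt.2 fun t =>
        (contDiffAt_pencilField hs hs' hgood (p := (t, x)) hx).continuousAt.comp
          (f := fun t => (t, x)) (by fun_prop)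
  obtain ⟨N, hN⟩ := exists_nat_ge (2 * (K : ℝ) + 1)
  have hN0 : (0 : ℝ) < N := by linarith [K.2]
  have key : ∀ m : ℕ, m ≤ N →
      AmbIso n (zeroLocus n k (pencil G U (s 0))) (zeroLocus n k (pencil G U (s (m / N)))) := by
    intro m
    induction m with
    | zero => intro _; simpa using AmbIso.refl _
    | succ m ih =>
      intro hm
      have hle : (m / N : ℝ) ≤ (m + 1 : ℕ) / N := by gcongr; simp
      have hsub : Icc (m / N : ℝ) ((m + 1 : ℕ) / N) ⊆ Icc 0 1 :=
        Icc_subset_Icc (by positivity) (by rw [div_le_one hN0]; exact_mod_cast hm)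
      refine (ih (by omega)).trans (AmbIso.of_vectorField hle (fun t ht => hK t (hsub ht))
        (fun x => (hcont x).continuousOn) hsm ?_
        fun α hα hα0 => eval_pencil_eq_zero_iff hs hs' hds hgood hle hα hα0)
      rw [← sub_div, Nat.cast_succ, add_sub_cancel_left, mul_one_div, div_le_iff₀ hN0]
      linarith
  simpa [hN0.ne'] using key N le_rfl

lemma hasDerivAt_arc (c t : ℝ) : HasDerivAt (arc c) (1 + Complex.I * (c * (1 - 2 * t))) t := by
  have h : HasDerivAt (fun t : ℝ => (t : ℂ)) 1 t := Complex.ofRealCLM.hasDerivAt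
  refine (h.add (((h.const_mul (c : ℂ)).mul (h.const_sub 1)).const_mul Complex.I)).congr_deriv ?_
  ring

end PencilFlow

/-- smooth complete intersections of the same multidegree are ambient
isotopic: there is a continuous `F : [0,1] × ℙⁿ(ℂ) → ℙⁿ(ℂ)` with `F(0,·) = id`,
`F(t,·)` a homeomorphism for each `t`, and `F(1,·)` mapping `X_G` onto `X_U`;
in particular `X_G` and `X_U` are homeomorphic. -/
theorem stmt19 (n k : ℕ) (hk : 1 ≤ k) (hkn : k ≤ n) (d : Fin k → ℕ) (hd : ∀ i, 1 ≤ d i)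
    (G U : Fin k → MvPolynomial (Fin (n + 1)) ℂ)
    (hG : IsSmoothCI n k G d) (hU : IsSmoothCI n k U d) :
    ∃ F : Set.Icc (0 : ℝ) 1 × ProjSp n → ProjSp n,
      Continuous F ∧
      (∀ x : ProjSp n, F (⟨0, Set.left_mem_Icc.mpr zero_le_one⟩, x) = x) ∧
      (∀ t : Set.Icc (0 : ℝ) 1, IsHomeomorph fun x : ProjSp n => F (t, x)) ∧
      (fun x : ProjSp n => F (⟨1, Set.right_mem_Icc.mpr zero_le_one⟩, x)) ''
          zeroLocus n k G = zeroLocus n k U := by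
  have hp0 : pencil G U 0 = G := by ext1 i; simp [pencil]
  have hp1 : pencil G U 1 = U := by ext1 i; simp [pencil]
  obtain ⟨c, hc⟩ := exists_arc_notMem (finite_setOf_not_isSmoothCI d G U hG hU.1)
    (fun h => h (by rwa [hp0])) (fun h => h (by rwa [hp1]))
  have hofReal : ContDiff ℝ 1 fun t : ℝ => (t : ℂ) := Complex.ofRealCLM.contDiff
  have h := ambIso_pencil (s := arc c) (s' := fun t => 1 + Complex.I * (c * (1 - 2 * t))) hd hG.1
    hU.1 (by unfold arc; fun_prop) (by fun_prop) (hasDerivAt_arc c) fun t => not_not.1 (hc t)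
  rwa [show arc c 0 = 0 by simp [arc], show arc c 1 = 1 by simp [arc], hp0, hp1] at h

end AmbientIsotopy
end
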